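/- arXiv:2012.03409 — 3 statements merged into one kernel-verified Lean document; each statement's English description precedes it below -/
import Mathlib

section
/- Suppose B = {b₁, b₂, …} is infinite, pairwise coprime, satisfies Σ 1/b_i < ∞, and b₁ = 2. Let X_η = X_B be the B-free subshift and φ = a₀₀·1_{[00]} + a₀₁·1_{[01]} + a₁·1_{[1]}. Then the topological pressure satisfies P(X_η, φ) = a₀₀(1 − 2d) + d·log₂(2^{a₁+a₀₁} + 2^{2a₀₀}), where d = ∏_{i=1}^∞ (1 − 1/b_i). -/
open Filter MeasureTheory

abbrev FullShift : Type := ℤ → Fin 2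

def shift (x : FullShift) : FullShift := fun i => x (i + 1)

def cylinder {n : ℕ} (W : Fin n → Fin 2) : Set FullShift :=
  {x | ∀ i : Fin n, x ((i : ℕ) : ℤ) = W i}

def ones {n : ℕ} (W : Fin n → Fin 2) : ℕ := (Finset.univ.filter fun i => W i = 1).card

def zeros {n : ℕ} (W : Fin n → Fin 2) : ℕ := (Finset.univ.filter fun i => W i = 0).card

noncomputable def birkhoff (φ : FullShift → ℝ) (n : ℕ) (x : FullShift) : ℝ :=
  ∑ i ∈ Finset.range n, φ (shift^[i] x)

def wordAt (x : FullShift) (n : ℕ) : Fin n → Fin 2 := fun i => x ((i : ℕ) : ℤ)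

def hereditaryClosure (X : Set FullShift) : Set FullShift :=
  {y | ∃ x ∈ X, ∀ i : ℤ, y i ≤ x i}

def Qmul (p : FullShift × FullShift) : FullShift := fun i => p.1 i * p.2 i

/-- φ = a₀₀·1_{[00]} + a₀₁·1_{[01]} + a₁·1_{[1]} -/
def phi012 (a00 a01 a1 : ℝ) (x : FullShift) : ℝ :=
  (if x 0 = 0 ∧ x 1 = 0 then a00 else 0) + (if x 0 = 0 ∧ x 1 = 1 then a01 else 0) +
    (if x 0 = 1 then a1 else 0)

/-- The B-admissible (B-free) subshift: the support of y misses a residue class mod each b i. -/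
def XB (b : ℕ → ℕ) : Set FullShift :=
  {y | ∀ i, ∃ r : ZMod (b i), ∀ m : ℤ, y m = 1 → (m : ZMod (b i)) ≠ r}

-- The partition function Z_n(X,φ) = Σ_{W ∈ L_n(X)} 2^{sup_{x∈W∩X} Birkhoff sum}.
open Classical in
noncomputable def Zn (X : Set FullShift) (φ : FullShift → ℝ) (n : ℕ) : ℝ :=
  ∑ W ∈ Finset.univ.filter (fun W : Fin n → Fin 2 => (X ∩ cylinder W).Nonempty),
    (2 : ℝ) ^ (sSup ((birkhoff φ n) '' (X ∩ cylinder W)))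


/-! ### The Birkhoff sums -/

lemma shift_iter (x : FullShift) (i : ℕ) (j : ℤ) : shift^[i] x j = x (j + i) := by
  induction i generalizing x with
  | zero => simp
  | succ k ih =>
    rw [Function.iterate_succ_apply, ih]
    simp only [shift]
    congr 1
    push_cast
    ring

lemma no_adj (b : ℕ → ℕ) (h2 : b 0 = 2) (x : FullShift) (hx : x ∈ XB b) (m : ℤ)
    (h0 : x m = 1) (h1 : x (m + 1) = 1) : False := by
  obtain ⟨r, hr⟩ := hx 0
  have e0 := hr m h0
  have e1 := hr (m + 1) h1
  revert r
  rw [h2]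
  intro r hr e0 e1
  clear hr
  push_cast at e1
  generalize ((m : ℤ) : ZMod 2) = z at e0 e1
  revert r z
  decide

/-- the indicator of a one -/
def uu (x : FullShift) (i : ℕ) : ℝ := if x (i : ℤ) = 1 then 1 else 0

lemma uu_nonneg (x : FullShift) (i : ℕ) : 0 ≤ uu x i := by unfold uu; split_ifs <;> norm_num
lemma uu_le (x : FullShift) (i : ℕ) : uu x i ≤ 1 := by unfold uu; split_ifs <;> norm_num

lemma phi_eq (b : ℕ → ℕ) (h2 : b 0 = 2) (a00 a01 a1 : ℝ) (x : FullShift) (hx : x ∈ XB b) (i : ℕ) :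
    phi012 a00 a01 a1 (shift^[i] x) =
      a00 + (a1 + a01 - 2 * a00) * uu x i + (a01 - a00) * (uu x (i + 1) - uu x i) := by
  have hna := no_adj b h2 x hx i
  simp only [phi012, shift_iter, uu]
  have e1 : ((0 : ℤ) + (i : ℤ)) = i := by ring
  have e2 : ((1 : ℤ) + (i : ℤ)) = i + 1 := by ring
  have e3 : (((i + 1 : ℕ) : ℤ)) = i + 1 := by push_cast; ring
  rw [e1, e2, e3]
  have c0 : x i = 0 ∨ x i = 1 := by
    generalize x i = z; revert z; decide
  have c1 : x (i + 1) = 0 ∨ x (i + 1) = 1 := by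
    generalize x (i + 1) = z; revert z; decide
  rcases c0 with c0 | c0 <;> rcases c1 with c1 | c1
  · simp [c0, c1]
  · simp [c0, c1]
  · simp [c0, c1]; ring
  · exact (hna c0 c1).elim

lemma birk_eq (b : ℕ → ℕ) (h2 : b 0 = 2) (a00 a01 a1 : ℝ) (x : FullShift) (hx : x ∈ XB b) (n : ℕ) :
    birkhoff (phi012 a00 a01 a1) n x =
      n * a00 + (a1 + a01 - 2 * a00) * (∑ i ∈ Finset.range n, uu x i)
        + (a01 - a00) * (uu x n - uu x 0) := by
  unfold birkhoff
  rw [Finset.sum_congr rfl (fun i _ => phi_eq b h2 a00 a01 a1 x hx i)]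
  rw [Finset.sum_add_distrib, Finset.sum_add_distrib, ← Finset.mul_sum, ← Finset.mul_sum,
    Finset.sum_range_sub]
  simp

/-- weight of a word -/
noncomputable def wt {n : ℕ} (t : ℝ) (W : Fin n → Fin 2) : ℝ := ∏ i, (if W i = 1 then t else 1)

lemma wt_nonneg {n : ℕ} {t : ℝ} (ht : 0 < t) (W : Fin n → Fin 2) : 0 ≤ wt t W :=
  Finset.prod_nonneg (fun i _ => by split_ifs <;> linarith)

lemma wt_eq {n : ℕ} (c : ℝ) (W : Fin n → Fin 2) (x : FullShift) (hx : x ∈ cylinder W) :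
    (2 : ℝ) ^ (c * ∑ i ∈ Finset.range n, uu x i) = wt ((2 : ℝ) ^ c) W := by
  rw [Finset.sum_range, Finset.mul_sum, Real.rpow_sum_of_pos (by norm_num)]
  unfold wt
  refine Finset.prod_congr rfl fun i _ => ?_
  have h := hx i
  unfold uu
  rw [h]
  split_ifs <;> simp

lemma abs_err (a : ℝ) (u v : ℝ) (hu : 0 ≤ u) (hu' : u ≤ 1) (hv : 0 ≤ v) (hv' : v ≤ 1) :
    |a * (u - v)| ≤ |a| := by
  rw [abs_mul]
  have : |u - v| ≤ 1 := by rw [abs_le]; constructor <;> linarith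
  nlinarith [abs_nonneg a]

lemma term_bounds (b : ℕ → ℕ) (h2 : b 0 = 2) (a00 a01 a1 : ℝ) {n : ℕ} (W : Fin n → Fin 2)
    (hW : (XB b ∩ cylinder W).Nonempty) :
    (2 : ℝ) ^ (-|a01 - a00| + n * a00) * wt ((2 : ℝ) ^ (a1 + a01 - 2 * a00)) W ≤
      (2 : ℝ) ^ (sSup ((birkhoff (phi012 a00 a01 a1) n) '' (XB b ∩ cylinder W))) ∧
    (2 : ℝ) ^ (sSup ((birkhoff (phi012 a00 a01 a1) n) '' (XB b ∩ cylinder W))) ≤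
      (2 : ℝ) ^ (|a01 - a00| + n * a00) * wt ((2 : ℝ) ^ (a1 + a01 - 2 * a00)) W := by
  obtain ⟨x₀, hx₀, hc₀⟩ := hW
  have key : ∀ x ∈ XB b ∩ cylinder W,
      |birkhoff (phi012 a00 a01 a1) n x -
        (n * a00 + (a1 + a01 - 2 * a00) * (∑ i ∈ Finset.range n, uu x₀ i))| ≤ |a01 - a00| := by
    rintro x ⟨hx, hc⟩
    have e : ∑ i ∈ Finset.range n, uu x i = ∑ i ∈ Finset.range n, uu x₀ i := by
      rw [Finset.sum_range, Finset.sum_range]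
      refine Finset.sum_congr rfl fun i _ => ?_
      unfold uu
      rw [hc i, hc₀ i]
    rw [birk_eq b h2 a00 a01 a1 x hx, e]
    rw [add_sub_cancel_left]
    exact abs_err _ _ _ (uu_nonneg _ _) (uu_le _ _) (uu_nonneg _ _) (uu_le _ _)
  have k0 := abs_le.1 (key x₀ ⟨hx₀, hc₀⟩)
  have hub : ∀ y ∈ (birkhoff (phi012 a00 a01 a1) n) '' (XB b ∩ cylinder W),
      y ≤ |a01 - a00| + n * a00 + (a1 + a01 - 2 * a00) * (∑ i ∈ Finset.range n, uu x₀ i) := by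
    rintro y ⟨x, hx, rfl⟩
    have := abs_le.1 (key x hx)
    linarith [this.2]
  have hmem : birkhoff (phi012 a00 a01 a1) n x₀ ∈
      (birkhoff (phi012 a00 a01 a1) n) '' (XB b ∩ cylinder W) := ⟨x₀, ⟨hx₀, hc₀⟩, rfl⟩
  have h1 := le_csSup ⟨_, hub⟩ hmem
  have h3 := csSup_le ⟨_, hmem⟩ hub
  rw [← wt_eq _ W x₀ hc₀, ← Real.rpow_add (by norm_num), ← Real.rpow_add (by norm_num)]
  constructor
  · apply Real.rpow_le_rpow_of_exponent_le (by norm_num)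
    linarith [k0.1]
  · apply Real.rpow_le_rpow_of_exponent_le (by norm_num)
    exact h3

/-! ### Sums over words supported in a set -/

/-- words supported in `F` -/
def wordsIn {n : ℕ} (F : Finset (Fin n)) : Finset (Fin n → Fin 2) :=
  Fintype.piFinset (fun i => if i ∈ F then Finset.univ else {0})

lemma mem_wordsIn {n : ℕ} (F : Finset (Fin n)) (W : Fin n → Fin 2) :
    W ∈ wordsIn F ↔ ∀ i, W i = 1 → i ∈ F := by
  unfold wordsIn
  rw [Fintype.mem_piFinset]
  refine forall_congr' fun i => ?_
  by_cases h : i ∈ F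
  · simp [h]
  · simp only [h, if_false, Finset.mem_singleton]
    generalize W i = z
    revert z; decide

lemma sum_wordsIn {n : ℕ} (F : Finset (Fin n)) (t : ℝ) :
    ∑ W ∈ wordsIn F, wt t W = (1 + t) ^ F.card := by
  unfold wordsIn wt
  rw [← Finset.prod_univ_sum (fun i : Fin n => if i ∈ F then (Finset.univ : Finset (Fin 2)) else {0})
    (fun _ v => if v = 1 then t else 1)]
  have : ∀ i : Fin n, (∑ v ∈ (if i ∈ F then (Finset.univ : Finset (Fin 2)) else {0}),
      (if v = 1 then t else 1)) = if i ∈ F then 1 + t else 1 := by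
    intro i
    split_ifs
    · simp [Fin.sum_univ_two]
    · simp
  rw [Finset.prod_congr rfl (fun i _ => this i), Finset.prod_ite_mem]
  simp

/-! ### Lower bound -/

lemma greedy (n : ℕ) (b : ℕ → ℕ) (hb : ∀ i, 2 ≤ b i) (N : ℕ) :
    ∃ F : Finset (Fin n), (n : ℝ) * ∏ i ∈ Finset.range N, (1 - 1 / (b i : ℝ)) ≤ F.card ∧
      ∀ i < N, ∃ r : ZMod (b i), ∀ m ∈ F, (((m : ℕ) : ℤ) : ZMod (b i)) ≠ r := by
  induction N with
  | zero => exact ⟨Finset.univ, by simp, by simp⟩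
  | succ k ih =>
    obtain ⟨F, hF, hr⟩ := ih
    have : NeZero (b k) := ⟨by have := hb k; omega⟩
    have hbk : (0 : ℝ) < b k := by have := hb k; exact_mod_cast (by omega : 0 < b k)
    have hbk2 : (2 : ℝ) ≤ b k := by exact_mod_cast hb k
    have hsum : ∑ r : ZMod (b k), ((F.filter
        (fun m : Fin n => (((m : ℕ) : ℤ) : ZMod (b k)) = r)).card : ℝ) = F.card := by
      have := Finset.card_eq_sum_card_fiberwise (s := F) (t := (Finset.univ : Finset (ZMod (b k))))
        (f := fun m : Fin n => (((m : ℕ) : ℤ) : ZMod (b k))) (by intro x _; simp)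
      rw [this]; push_cast; rfl
    obtain ⟨r, -, hr'⟩ : ∃ r ∈ (Finset.univ : Finset (ZMod (b k))), ((F.filter
        (fun m : Fin n => (((m : ℕ) : ℤ) : ZMod (b k)) = r)).card : ℝ) ≤ F.card / b k := by
      apply Finset.exists_le_of_sum_le (Finset.univ_nonempty)
      rw [hsum]
      simp [ZMod.card]
      field_simp
      exact le_rfl
    refine ⟨F.filter (fun m : Fin n => ¬ (((m : ℕ) : ℤ) : ZMod (b k)) = r), ?_, ?_⟩
    · have hc := Finset.card_filter_add_card_filter_not (s := F)
        (fun m : Fin n => (((m : ℕ) : ℤ) : ZMod (b k)) = r)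
      have hc' : ((F.filter (fun m : Fin n => (((m : ℕ) : ℤ) : ZMod (b k)) = r)).card : ℝ) +
        ((F.filter (fun m : Fin n => ¬ (((m : ℕ) : ℤ) : ZMod (b k)) = r)).card : ℝ) = F.card := by
        exact_mod_cast hc
      rw [Finset.prod_range_succ, ← mul_assoc]
      have h0 : 0 ≤ 1 - 1 / (b k : ℝ) := by
        rw [sub_nonneg, div_le_one hbk]; linarith
      have h1 := mul_le_mul_of_nonneg_right hF h0
      have h3 : (F.card : ℝ) * (1 - 1 / (b k : ℝ)) = F.card - F.card / b k := by ring
      linarith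
    · intro i hi
      rcases Nat.lt_succ_iff_lt_or_eq.1 hi with h | h
      · obtain ⟨s, hs⟩ := hr i h
        exact ⟨s, fun m hm => hs m (Finset.mem_filter.1 hm).1⟩
      · subst h
        exact ⟨r, fun m hm => (Finset.mem_filter.1 hm).2⟩

/-- zero padding -/
def padw {n : ℕ} (W : Fin n → Fin 2) : FullShift :=
  fun m => if h : 0 ≤ m ∧ m < n then W ⟨m.toNat, by omega⟩ else 0

lemma padw_cyl {n : ℕ} (W : Fin n → Fin 2) : padw W ∈ cylinder W := by
  intro i
  have : (0 : ℤ) ≤ ((i : ℕ) : ℤ) ∧ ((i : ℕ) : ℤ) < n := ⟨by omega, by have := i.2; omega⟩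
  simp [padw]

lemma padw_one {n : ℕ} (W : Fin n → Fin 2) (m : ℤ) (h : padw W m = 1) :
    ∃ i : Fin n, ((i : ℕ) : ℤ) = m ∧ W i = 1 := by
  unfold padw at h
  split_ifs at h with h'
  · exact ⟨⟨m.toNat, by omega⟩, by simp [h'.1], h⟩
  · simp at h

lemma lower_sum (b : ℕ → ℕ) (hb : ∀ i, 2 ≤ b i)
    (hsum : Summable fun i => (1 : ℝ) / b i) (d : ℝ)
    (hd : ∀ N, d ≤ ∏ i ∈ Finset.range N, (1 - 1 / (b i : ℝ))) (n : ℕ) :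
    ∃ F : Finset (Fin n), (n : ℝ) * d ≤ F.card ∧
      ∀ W ∈ wordsIn F, (XB b ∩ cylinder W).Nonempty := by
  obtain ⟨N, hN⟩ : ∃ N, ∀ i ≥ N, n < b i := by
    have h := hsum.tendsto_atTop_zero
    have hp : (0 : ℝ) < 1 / (n + 1) := by positivity
    obtain ⟨N, hN⟩ := eventually_atTop.1 (h.eventually (gt_mem_nhds hp))
    refine ⟨N, fun i hi => ?_⟩
    have := hN i hi
    have hbi : (0 : ℝ) < b i := by have := hb i; exact_mod_cast (by omega : 0 < b i)
    rw [div_lt_div_iff₀ hbi (by positivity)] at this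
    have h' : ((n + 1 : ℕ) : ℝ) < b i := by push_cast; linarith
    have := Nat.cast_lt.1 h'
    omega
  obtain ⟨F, hF, hr⟩ := greedy n b hb N
  refine ⟨F, le_trans (mul_le_mul_of_nonneg_left (hd N) (by positivity)) hF, fun W hW => ?_⟩
  rw [mem_wordsIn] at hW
  refine ⟨padw W, fun i => ?_, padw_cyl W⟩
  by_cases hi : i < N
  · obtain ⟨r, hr⟩ := hr i hi
    refine ⟨r, fun m hm => ?_⟩
    obtain ⟨j, rfl, hj⟩ := padw_one W m hm
    exact hr j (hW j hj)
  · refine ⟨(n : ZMod (b i)), fun m hm => ?_⟩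
    obtain ⟨j, rfl, hj⟩ := padw_one W m hm
    have hbi := hN i (by omega)
    have hj := j.2
    intro he
    have he' : (((j : ℕ)) : ZMod (b i)) = ((n : ℕ) : ZMod (b i)) := by exact_mod_cast he
    rw [ZMod.natCast_eq_natCast_iff] at he'
    have := Nat.ModEq.eq_of_lt_of_lt he' (by omega) hbi
    omega

/-! ### Upper bound -/

lemma block_card (b : ℕ → ℕ) (hb : ∀ i, 2 ≤ b i)
    (hcop : ∀ i j, i ≠ j → Nat.Coprime (b i) (b j)) (K : ℕ) (r : ∀ i : Fin K, ZMod (b i)) (a : ℕ) :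
    ((Finset.Ico a (a + ∏ i : Fin K, b i)).filter
      (fun m => ∀ i : Fin K, (m : ZMod (b i)) ≠ r i)).card ≤ ∏ i : Fin K, (b i - 1) := by
  have : ∀ i, NeZero (b i) := fun i => ⟨by have := hb i; omega⟩
  have hc : (Fintype.piFinset (fun i : Fin K => (Finset.univ : Finset (ZMod (b i))).erase (r i))).card
      = ∏ i : Fin K, (b i - 1) := by
    rw [Fintype.card_piFinset]
    refine Finset.prod_congr rfl fun i _ => ?_
    rw [Finset.card_erase_of_mem (Finset.mem_univ _), Finset.card_univ, ZMod.card]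
  rw [← hc]
  apply Finset.card_le_card_of_injOn (fun (m : ℕ) (i : Fin K) => (m : ZMod (b i)))
  · intro m hm
    simp only [Finset.coe_filter, Set.mem_setOf_eq] at hm
    simp only [Finset.mem_coe, Fintype.mem_piFinset, Finset.mem_erase, Finset.mem_univ, and_true]
    exact hm.2
  · have aux : ∀ m m' : ℕ, a ≤ m → m ≤ m' → m' < a + ∏ i : Fin K, b i →
        (∀ i : Fin K, (m : ZMod (b i)) = (m' : ZMod (b i))) → m = m' := by
      intro m m' h1 h2 h3 h4
      have hdvd : (∏ i : Fin K, b i) ∣ m' - m := by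
        apply Finset.prod_dvd_of_isRelPrime
        · intro i _ j _ hij
          exact Nat.coprime_iff_isRelPrime.1 (hcop i j (fun h => hij (Fin.ext h)))
        · intro i _
          exact (Nat.modEq_iff_dvd' h2).1 ((ZMod.natCast_eq_natCast_iff _ _ _).1 (h4 i))
      have := Nat.eq_zero_of_dvd_of_lt hdvd (by omega)
      omega
    intro m hm m' hm' he
    simp only [Finset.coe_filter, Set.mem_setOf_eq, Finset.mem_Ico] at hm hm'
    have he' : ∀ i : Fin K, (m : ZMod (b i)) = (m' : ZMod (b i)) := fun i => congrFun he i
    rcases le_total m m' with h | h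
    · exact aux m m' hm.1.1 h hm'.1.2 he'
    · exact (aux m' m hm'.1.1 h hm.1.2 (fun i => (he' i).symm)).symm

lemma blocks_card (p : ℕ → Prop) [DecidablePred p] (M c : ℕ)
    (h : ∀ a, ((Finset.Ico a (a + M)).filter p).card ≤ c) (q : ℕ) :
    ((Finset.range (q * M)).filter p).card ≤ q * c := by
  induction q with
  | zero => simp
  | succ k ih =>
    have e : Finset.range ((k + 1) * M) = Finset.range (k * M) ∪ Finset.Ico (k * M) (k * M + M) := by
      ext x
      simp only [Finset.mem_range, Finset.mem_union, Finset.mem_Ico]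
      rw [Nat.add_mul, one_mul]
      omega
    rw [e, Finset.filter_union]
    refine (Finset.card_union_le _ _).trans ?_
    rw [Nat.add_mul, one_mul]
    exact Nat.add_le_add ih (h _)

lemma F_card (b : ℕ → ℕ) (hb : ∀ i, 2 ≤ b i)
    (hcop : ∀ i j, i ≠ j → Nat.Coprime (b i) (b j)) (K : ℕ) (r : ∀ i : Fin K, ZMod (b i)) (n : ℕ) :
    ((Finset.univ.filter
      (fun m : Fin n => ∀ i : Fin K, ((m : ℕ) : ZMod (b i)) ≠ r i)).card : ℝ) ≤
      n * ∏ i ∈ Finset.range K, (1 - 1 / (b i : ℝ)) + ∏ i ∈ Finset.range K, (b i : ℝ) := by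
  set M := ∏ i : Fin K, b i with hM
  set c := ∏ i : Fin K, (b i - 1) with hc
  have hMpos : 0 < M := Finset.prod_pos fun i _ => by have := hb i; omega
  have h1 := blocks_card (fun m => ∀ i : Fin K, (m : ZMod (b i)) ≠ r i) M c
    (block_card b hb hcop K r) (n / M + 1)
  have h2 : (Finset.univ.filter
      (fun m : Fin n => ∀ i : Fin K, ((m : ℕ) : ZMod (b i)) ≠ r i)).card ≤
      ((Finset.range ((n / M + 1) * M)).filter
        (fun m => ∀ i : Fin K, (m : ZMod (b i)) ≠ r i)).card := by
    apply Finset.card_le_card_of_injOn (fun m : Fin n => (m : ℕ))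
    · intro m hm
      simp only [Finset.coe_filter, Set.mem_setOf_eq, Finset.mem_univ, true_and] at hm
      simp only [Finset.coe_filter, Set.mem_setOf_eq, Finset.mem_range]
      refine ⟨?_, hm⟩
      have := Nat.lt_div_mul_add (a := n) hMpos
      have := m.2
      rw [Nat.add_mul, one_mul]
      omega
    · intro m _ m' _ h
      exact Fin.ext h
  have h3 : ((Finset.univ.filter
      (fun m : Fin n => ∀ i : Fin K, ((m : ℕ) : ZMod (b i)) ≠ r i)).card : ℝ) ≤
      ((n / M : ℕ) + 1 : ℝ) * c := by
    exact_mod_cast h2.trans h1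
  have hMr : (M : ℝ) = ∏ i ∈ Finset.range K, (b i : ℝ) := by
    rw [hM, Finset.prod_range]; push_cast; rfl
  have hMpos' : (0 : ℝ) < M := by exact_mod_cast hMpos
  have hcr : (c : ℝ) = M * ∏ i ∈ Finset.range K, (1 - 1 / (b i : ℝ)) := by
    rw [hMr, ← Finset.prod_mul_distrib, hc, Finset.prod_range]
    push_cast
    refine Finset.prod_congr rfl fun i _ => ?_
    have := hb i
    have hbi : (b i : ℝ) ≠ 0 := by exact_mod_cast (by omega : b i ≠ 0)
    rw [Nat.cast_sub (by omega)]
    field_simp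
    simp
  have hcM : (c : ℝ) ≤ M := by
    exact_mod_cast Finset.prod_le_prod' fun i _ => Nat.sub_le _ _
  have hdiv : ((n / M : ℕ) : ℝ) ≤ n / M := Nat.cast_div_le
  rw [← hMr]
  have h4 : ((n / M : ℕ) : ℝ) * c ≤ n / M * c := mul_le_mul_of_nonneg_right hdiv (by positivity)
  have h5 : (n / M * c : ℝ) = n * ∏ i ∈ Finset.range K, (1 - 1 / (b i : ℝ)) := by
    rw [hcr]; field_simp
  linarith

lemma sum_biUnion_le_aux {ι α : Type*} [DecidableEq ι] [DecidableEq α] (s : Finset ι)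
    (f : ι → Finset α) (g : α → ℝ) (hg : ∀ a, 0 ≤ g a) :
    ∑ a ∈ s.biUnion f, g a ≤ ∑ i ∈ s, ∑ a ∈ f i, g a := by
  induction s using Finset.induction_on with
  | empty => simp
  | insert i s hi ih =>
    rw [Finset.biUnion_insert, Finset.sum_insert hi]
    have h1 := Finset.sum_union_inter (s₁ := f i) (s₂ := s.biUnion f) (f := g)
    have h2 : 0 ≤ ∑ a ∈ f i ∩ s.biUnion f, g a := Finset.sum_nonneg fun a _ => hg a
    linarith

open Classical in
lemma upper_sum (b : ℕ → ℕ) (hb : ∀ i, 2 ≤ b i)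
    (hcop : ∀ i j, i ≠ j → Nat.Coprime (b i) (b j)) (t : ℝ) (ht : 0 < t) (K n : ℕ) :
    ∑ W ∈ Finset.univ.filter (fun W : Fin n → Fin 2 => (XB b ∩ cylinder W).Nonempty), wt t W ≤
      (∏ i ∈ Finset.range K, (b i : ℝ)) * (1 + t) ^
        ((n : ℝ) * ∏ i ∈ Finset.range K, (1 - 1 / (b i : ℝ)) + ∏ i ∈ Finset.range K, (b i : ℝ)) := by
  have : ∀ i, NeZero (b i) := fun i => ⟨by have := hb i; omega⟩
  let FF : (∀ i : Fin K, ZMod (b i)) → Finset (Fin n) := fun r => Finset.univ.filter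
      (fun m : Fin n => ∀ i : Fin K, ((m : ℕ) : ZMod (b i)) ≠ r i)
  have hsub : Finset.univ.filter (fun W : Fin n → Fin 2 => (XB b ∩ cylinder W).Nonempty) ⊆
      Finset.univ.biUnion (fun r => wordsIn (FF r)) := by
    intro W hW
    obtain ⟨x, hx, hc⟩ := (Finset.mem_filter.1 hW).2
    choose r hr using hx
    rw [Finset.mem_biUnion]
    refine ⟨fun i => r i, Finset.mem_univ _, ?_⟩
    rw [mem_wordsIn]
    intro m hm
    simp only [FF, Finset.mem_filter, Finset.mem_univ, true_and]
    intro i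
    have := hr i (m : ℕ) (by rw [hc m, hm])
    exact_mod_cast this
  calc _ ≤ ∑ W ∈ Finset.univ.biUnion (fun r => wordsIn (FF r)), wt t W :=
        Finset.sum_le_sum_of_subset_of_nonneg hsub (fun W _ _ => wt_nonneg ht W)
    _ ≤ ∑ r, ∑ W ∈ wordsIn (FF r), wt t W :=
        sum_biUnion_le_aux _ _ _ (fun W => wt_nonneg ht W)
    _ = ∑ r, (1 + t) ^ ((FF r).card : ℝ) := by
        refine Finset.sum_congr rfl fun r _ => ?_
        rw [sum_wordsIn, Real.rpow_natCast]
    _ ≤ ∑ r : (∀ i : Fin K, ZMod (b i)), (1 + t) ^ ((n : ℝ) * ∏ i ∈ Finset.range K, (1 - 1 / (b i : ℝ)) +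
          ∏ i ∈ Finset.range K, (b i : ℝ)) := by
        refine Finset.sum_le_sum fun r _ => ?_
        exact Real.rpow_le_rpow_of_exponent_le (by linarith) (F_card b hb hcop K r n)
    _ = _ := by
        rw [Finset.sum_const, nsmul_eq_mul, Finset.card_univ, Fintype.card_pi]
        congr 1
        rw [Finset.prod_range]
        push_cast
        simp [ZMod.card]

theorem stmt12 (b : ℕ → ℕ) (hb : ∀ i, 2 ≤ b i)
    (hcop : ∀ i j, i ≠ j → Nat.Coprime (b i) (b j))
    (hsum : Summable fun i => (1 : ℝ) / b i) (h2 : b 0 = 2)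
    (a00 a01 a1 d : ℝ) (hd : d = ∏' i, (1 - 1 / (b i : ℝ))) :
    Tendsto (fun n : ℕ => Real.logb 2 (Zn (XB b) (phi012 a00 a01 a1) n) / n) atTop
      (nhds (a00 * (1 - 2 * d) +
        d * Real.logb 2 ((2 : ℝ) ^ (a1 + a01) + (2 : ℝ) ^ (2 * a00)))) := by
  classical
  set C := |a01 - a00| with hC
  set t : ℝ := (2 : ℝ) ^ (a1 + a01 - 2 * a00) with ht_def
  have ht : 0 < t := by positivity
  set l := Real.logb 2 (1 + t) with hl
  set D : ℕ → ℝ := fun N => ∏ i ∈ Finset.range N, (1 - 1 / (b i : ℝ)) with hD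
  have hDt : Tendsto D atTop (nhds d) := by
    have hm : Multipliable (fun i => (1 - 1 / (b i : ℝ))) := by
      have := Real.multipliable_one_add_of_summable (f := fun i => - (1 / (b i : ℝ))) hsum.neg
      simpa [sub_eq_add_neg] using this
    rw [hd]
    exact hm.tendsto_prod_tprod_nat
  have hfac : ∀ i, 0 ≤ 1 - 1 / (b i : ℝ) ∧ 1 - 1 / (b i : ℝ) ≤ 1 := by
    intro i
    have h : (2 : ℝ) ≤ b i := by exact_mod_cast hb i
    have h0 : 0 < 1 / (b i : ℝ) := by positivity
    have h1 : 1 / (b i : ℝ) ≤ 1 := by rw [div_le_one (by linarith)]; linarith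
    constructor <;> linarith
  have hanti : Antitone D := by
    apply antitone_nat_of_succ_le
    intro k
    simp only [hD, Finset.prod_range_succ]
    exact mul_le_of_le_one_right (Finset.prod_nonneg fun i _ => (hfac i).1) (hfac k).2
  have hdD : ∀ N, d ≤ D N := fun N => hanti.le_of_tendsto hDt N
  have hlim : a00 * (1 - 2 * d) + d * Real.logb 2 ((2 : ℝ) ^ (a1 + a01) + (2 : ℝ) ^ (2 * a00))
      = a00 + d * l := by
    have e : (2 : ℝ) ^ (a1 + a01) + (2 : ℝ) ^ (2 * a00) = 2 ^ (2 * a00) * (1 + t) := by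
      rw [mul_add, ht_def, ← Real.rpow_add (by norm_num), mul_one]
      ring_nf
    rw [e, Real.logb_mul (by positivity) (by positivity), Real.logb_rpow (by norm_num) (by norm_num)]
    ring
  rw [hlim]
  have hlow : ∀ n : ℕ, (2 : ℝ) ^ (-C + n * a00) * (1 + t) ^ ((n : ℝ) * d) ≤
      Zn (XB b) (phi012 a00 a01 a1) n := by
    intro n
    obtain ⟨F, hF, hW⟩ := lower_sum b hb hsum d hdD n
    unfold Zn
    calc _ ≤ (2 : ℝ) ^ (-C + n * a00) * ∑ W ∈ wordsIn F, wt t W := by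
          rw [sum_wordsIn, ← Real.rpow_natCast]
          apply mul_le_mul_of_nonneg_left _ (by positivity)
          exact Real.rpow_le_rpow_of_exponent_le (by linarith) hF
      _ = ∑ W ∈ wordsIn F, (2 : ℝ) ^ (-C + n * a00) * wt t W := Finset.mul_sum _ _ _
      _ ≤ ∑ W ∈ wordsIn F,
          (2 : ℝ) ^ (sSup ((birkhoff (phi012 a00 a01 a1) n) '' (XB b ∩ cylinder W))) :=
          Finset.sum_le_sum fun W h => (term_bounds b h2 a00 a01 a1 W (hW W h)).1
      _ ≤ _ := by
          apply Finset.sum_le_sum_of_subset_of_nonneg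
          · intro W h
            simp only [Finset.mem_filter, Finset.mem_univ, true_and]
            exact hW W h
          · intro W _ _
            positivity
  have hup : ∀ K n : ℕ, Zn (XB b) (phi012 a00 a01 a1) n ≤ (2 : ℝ) ^ (C + n * a00) *
      ((∏ i ∈ Finset.range K, (b i : ℝ)) * (1 + t) ^ ((n : ℝ) * D K +
        ∏ i ∈ Finset.range K, (b i : ℝ))) := by
    intro K n
    refine le_trans ?_ (mul_le_mul_of_nonneg_left (upper_sum b hb hcop t ht K n) (by positivity))
    unfold Zn
    rw [Finset.mul_sum]
    exact Finset.sum_le_sum fun W h =>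
      (term_bounds b h2 a00 a01 a1 W (by simpa using h)).2
  have hZpos : ∀ n, 0 < Zn (XB b) (phi012 a00 a01 a1) n := fun n =>
    lt_of_lt_of_le (by positivity) (hlow n)
  have hlow' : ∀ n : ℕ, 0 < n → a00 + d * l + (-C) / n ≤
      Real.logb 2 (Zn (XB b) (phi012 a00 a01 a1) n) / n := by
    intro n hn
    have hn' : (0 : ℝ) < n := by exact_mod_cast hn
    have h := Real.logb_le_logb_of_le (b := 2) (by norm_num) (by positivity) (hlow n)
    rw [Real.logb_mul (by positivity) (by positivity), Real.logb_rpow (by norm_num) (by norm_num),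
      Real.logb_rpow_eq_mul_logb_of_pos (by positivity), ← hl] at h
    rw [le_div_iff₀ hn']
    refine le_trans (le_of_eq ?_) h
    field_simp
    ring
  have hup' : ∀ K, ∀ n : ℕ, 0 < n → Real.logb 2 (Zn (XB b) (phi012 a00 a01 a1) n) / n ≤
      a00 + D K * l + (C + Real.logb 2 (∏ i ∈ Finset.range K, (b i : ℝ)) +
        (∏ i ∈ Finset.range K, (b i : ℝ)) * l) / n := by
    intro K n hn
    have hn' : (0 : ℝ) < n := by exact_mod_cast hn
    have hP : (0 : ℝ) < ∏ i ∈ Finset.range K, (b i : ℝ) := Finset.prod_pos fun i _ => by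
      have := hb i
      exact_mod_cast (by omega : 0 < b i)
    have h := Real.logb_le_logb_of_le (b := 2) (by norm_num) (hZpos n) (hup K n)
    rw [Real.logb_mul (by positivity) (by positivity), Real.logb_rpow (by norm_num) (by norm_num),
      Real.logb_mul (by positivity) (by positivity),
      Real.logb_rpow_eq_mul_logb_of_pos (by positivity), ← hl] at h
    rw [div_le_iff₀ hn']
    refine le_trans h (le_of_eq ?_)
    field_simp
    ring
  rw [tendsto_order]
  constructor
  · intro a ha
    have h : Tendsto (fun n : ℕ => a00 + d * l + (-C) / n) atTop (nhds (a00 + d * l + 0)) :=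
      tendsto_const_nhds.add (tendsto_const_div_atTop_nhds_zero_nat _)
    rw [add_zero] at h
    filter_upwards [h.eventually (lt_mem_nhds ha), eventually_gt_atTop 0] with n h1 h3
    exact lt_of_lt_of_le h1 (hlow' n h3)
  · intro a ha
    have hK : Tendsto (fun K => a00 + D K * l) atTop (nhds (a00 + d * l)) :=
      tendsto_const_nhds.add (hDt.mul_const l)
    obtain ⟨K, hK⟩ := (hK.eventually (gt_mem_nhds ha)).exists
    have h : Tendsto (fun n : ℕ => a00 + D K * l + (C + Real.logb 2 (∏ i ∈ Finset.range K, (b i : ℝ)) +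
        (∏ i ∈ Finset.range K, (b i : ℝ)) * l) / n) atTop (nhds (a00 + D K * l + 0)) :=
      tendsto_const_nhds.add (tendsto_const_div_atTop_nhds_zero_nat _)
    rw [add_zero] at h
    filter_upwards [h.eventually (gt_mem_nhds hK), eventually_gt_atTop 0] with n h1 h3
    exact lt_of_le_of_lt (hup' K n h3) h1
end

section
/- Suppose B is infinite, pairwise coprime, Σ1/b < ∞, and 2 ∈ B. Let φ = a₀₀·1_{[00]} + a₀₁·1_{[01]} + a₁·1_{[1]} with a₁ ≥ max{a₀₀, a₀₁} and 2a₀₀ ≤ a₁ + a₀₁, and let p = 2^{2a₀₀}/(2^{a₁+a₀₁} + 2^{2a₀₀}). Then the measure κ = ν_η ∗ B_{p,1−p} is not a Gibbs measure for φ on X_η, i.e., there is no constant c > 0 such that c⁻¹ ≤ κ(x[0,n−1]) · 2^{nP − Σ_{i<n}φ(Sⁱx)} ≤ c for all n, all κ-positive cylinders of length n, and all x in them, where P = P(X_η, φ). -/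
open Filter MeasureTheory

/-- κ is a Gibbs measure for φ (with pressure constant P) on the subshift Y. -/
def IsGibbs (Y : Set FullShift) (κ : Measure FullShift) (φ : FullShift → ℝ) (P : ℝ) : Prop :=
  ∃ c : ℝ, 0 < c ∧ ∀ (n : ℕ) (x : FullShift), x ∈ Y → 0 < κ (cylinder (wordAt x n)) →
    c⁻¹ ≤ (κ (cylinder (wordAt x n))).toReal / (2 : ℝ) ^ (birkhoff φ n x - n * P) ∧
      (κ (cylinder (wordAt x n))).toReal / (2 : ℝ) ^ (birkhoff φ n x - n * P) ≤ c

-- Number of times 0 ≤ i < n such that Sⁱx lies in the cylinder of W.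
open Classical in
noncomputable def freqCount (x : FullShift) {k : ℕ} (W : Fin k → Fin 2) (n : ℕ) : ℕ :=
  ((Finset.range n).filter fun i => shift^[i] x ∈ cylinder W).card

namespace S17

lemma shift_iter (x : FullShift) (s : ℕ) (m : ℤ) : (shift^[s] x) m = x (m + s) := by
  induction s generalizing x with
  | zero => simp
  | succ k ih =>
    rw [Function.iterate_succ_apply, ih]
    simp only [shift]
    congr 1
    push_cast; ring

lemma mem_cyl_iter (x : FullShift) (s : ℕ) {n : ℕ} (W : Fin n → Fin 2) :
    shift^[s] x ∈ _root_.cylinder W ↔ wordAt (shift^[s] x) n = W := by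
  rw [funext_iff]
  exact Iff.rfl

/-- sieve count -/
lemma sieve (b : ℕ → ℕ) (hb : ∀ i, 2 ≤ b i)
    (hcop : ∀ i j, i ≠ j → Nat.Coprime (b i) (b j)) (k : ℕ) :
    ∃ C : ℝ, ∀ N : ℕ,
      |(((Finset.range N).filter fun s => ∀ i < k, ¬ (b i ∣ s)).card : ℝ)
        - N * ∏ i ∈ Finset.range k, (1 - 1 / (b i : ℝ))| ≤ C := by
  induction k with
  | zero => exact ⟨0, fun N => by simp⟩
  | succ k ih =>
    obtain ⟨C, hC⟩ := ih
    refine ⟨C + (C + 1), fun N => ?_⟩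
    have hbk : 0 < b k := by have := hb k; omega
    set M := (N + b k - 1) / b k with hM
    have hMlt : ∀ t, t < M ↔ b k * t < N := by
      intro t
      rw [hM, Nat.lt_div_iff_mul_lt hbk, mul_comm]
      constructor <;> intro h <;> omega
    have h1 : ((Finset.range N).filter fun s => ∀ i < k + 1, ¬ (b i ∣ s)).card
        + ((Finset.range M).filter fun s => ∀ i < k, ¬ (b i ∣ s)).card
        = ((Finset.range N).filter fun s => ∀ i < k, ¬ (b i ∣ s)).card := by
      have e1 : ((Finset.range M).filter fun s => ∀ i < k, ¬ (b i ∣ s)).card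
          = (((Finset.range N).filter fun s => ∀ i < k, ¬ (b i ∣ s)).filter
              fun s => b k ∣ s).card := by
        rw [← Finset.card_image_of_injective _
          (show Function.Injective (fun t => b k * t) from fun x y h =>
            Nat.eq_of_mul_eq_mul_left hbk h)]
        congr 1
        ext s
        simp only [Finset.mem_image, Finset.mem_filter, Finset.mem_range]
        constructor
        · rintro ⟨t, ⟨ht, h⟩, rfl⟩
          refine ⟨⟨(hMlt t).1 ht, fun i hi hd => h i hi ?_⟩, dvd_mul_right _ _⟩
          exact (hcop i k (by omega)).dvd_of_dvd_mul_left hd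
        · rintro ⟨⟨hs, h⟩, t, rfl⟩
          exact ⟨t, ⟨(hMlt t).2 hs, fun i hi hd => h i hi (hd.mul_left _)⟩, rfl⟩
      have e2 : ((Finset.range N).filter fun s => ∀ i < k + 1, ¬ (b i ∣ s))
          = (((Finset.range N).filter fun s => ∀ i < k, ¬ (b i ∣ s)).filter
              fun s => ¬ b k ∣ s) := by
        ext s
        simp only [Finset.mem_filter, Finset.mem_range, Nat.lt_succ_iff_lt_or_eq, or_imp,
          forall_and, forall_eq, and_assoc]
      rw [e1, e2, add_comm]
      exact Finset.card_filter_add_card_filter_not _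
    have hN := hC N
    have hMM := hC M
    set D := ∏ i ∈ Finset.range k, (1 - 1 / (b i : ℝ)) with hD
    have hbi : ∀ i, 0 ≤ 1 - 1 / (b i : ℝ) ∧ 1 - 1 / (b i : ℝ) ≤ 1 := by
      intro i
      have : (2 : ℝ) ≤ b i := by exact_mod_cast hb i
      constructor
      · rw [sub_nonneg, div_le_one (by linarith)]; linarith
      · have : 0 ≤ 1 / (b i : ℝ) := by positivity
        linarith
    have hD0 : 0 ≤ D := Finset.prod_nonneg fun i _ => (hbi i).1
    have hD1 : D ≤ 1 := Finset.prod_le_one (fun i _ => (hbi i).1) (fun i _ => (hbi i).2)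
    have hbR : (0 : ℝ) < b k := by exact_mod_cast hbk
    have hm1 : (N : ℝ) / b k ≤ M := by
      rw [div_le_iff₀ hbR]
      have := (hMlt M).not.1 (lt_irrefl _)
      have : N ≤ M * b k := by rw [mul_comm]; omega
      exact_mod_cast this
    have hm2 : (M : ℝ) ≤ N / b k + 1 := by
      have : M * b k ≤ N + b k - 1 := Nat.div_mul_le_self _ _
      have : M * b k ≤ N + b k := by omega
      have : (M : ℝ) * b k ≤ N + b k := by exact_mod_cast this
      rw [div_add_one hbR.ne', le_div_iff₀ hbR]; exact this
    have h1R : (((Finset.range N).filter fun s => ∀ i < k + 1, ¬ (b i ∣ s)).card : ℝ)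
        = (((Finset.range N).filter fun s => ∀ i < k, ¬ (b i ∣ s)).card : ℝ)
        - (((Finset.range M).filter fun s => ∀ i < k, ¬ (b i ∣ s)).card : ℝ) := by
      rw [← h1]; push_cast; ring
    rw [h1R, Finset.prod_range_succ, ← hD]
    rw [abs_le] at *
    have x1 : 0 ≤ (M - (N : ℝ) / b k) * D := mul_nonneg (by linarith) hD0
    have x2 : (M - (N : ℝ) / b k) * D ≤ 1 := by
      calc _ ≤ (1 : ℝ) * 1 := mul_le_mul (by linarith) hD1 hD0 zero_le_one
        _ = 1 := one_mul _
    have x3 : (N : ℝ) * (D * (1 - 1 / (b k : ℝ))) = N * D - M * D + (M - (N : ℝ) / b k) * D := by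
      field_simp; ring
    rw [x3]
    constructor <;> linarith [hN.1, hN.2, hMM.1, hMM.2]

open Classical in
lemma tail_count (b : ℕ → ℕ) (hb : ∀ i, 2 ≤ b i)
    (hsum : Summable fun i => (1 : ℝ) / b i) (k N : ℕ) :
    (((Finset.range N).filter fun s => s ≠ 0 ∧ ∃ i ≥ k, b i ∣ s).card : ℝ)
      ≤ N * ∑' i, (1 : ℝ) / b (i + k) := by
  set S := (Finset.range N).filter fun s => s ≠ 0 ∧ ∃ i ≥ k, b i ∣ s with hS
  have hch : ∀ s : ℕ, ∃ i, s ∈ S → b (i + k) ∣ s := by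
    intro s
    by_cases h : s ∈ S
    · obtain ⟨i, hi, hd⟩ := (Finset.mem_filter.1 h).2.2
      exact ⟨i - k, fun _ => by rwa [Nat.sub_add_cancel hi]⟩
    · exact ⟨0, fun h' => absurd h' h⟩
  choose f hf using hch
  set I := S.image f
  have hsub : S ⊆ I.biUnion fun i => (Finset.Ioc 0 N).filter fun s => b (i + k) ∣ s := by
    intro s hs
    rw [Finset.mem_biUnion]
    refine ⟨f s, Finset.mem_image_of_mem _ hs, Finset.mem_filter.2 ⟨?_, hf s hs⟩⟩
    have := Finset.mem_filter.1 hs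
    rw [Finset.mem_range] at this
    rw [Finset.mem_Ioc]; omega
  have hsum' : Summable fun i => (1 : ℝ) / b (i + k) := (summable_nat_add_iff k).2 hsum
  calc (S.card : ℝ) ≤ ((∑ i ∈ I, ((Finset.Ioc 0 N).filter fun s => b (i + k) ∣ s).card : ℕ) : ℝ) := by
        exact_mod_cast (Finset.card_le_card hsub).trans Finset.card_biUnion_le
    _ = ∑ i ∈ I, ((N / b (i + k) : ℕ) : ℝ) := by
        push_cast
        refine Finset.sum_congr rfl fun i _ => ?_
        rw [Nat.Ioc_filter_dvd_card_eq_div]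
    _ ≤ ∑ i ∈ I, (N : ℝ) * (1 / b (i + k)) := by
        refine Finset.sum_le_sum fun i _ => ?_
        rw [mul_one_div]; exact Nat.cast_div_le
    _ = N * ∑ i ∈ I, (1 : ℝ) / b (i + k) := by rw [Finset.mul_sum]
    _ ≤ _ := by
        refine mul_le_mul_of_nonneg_left ?_ (Nat.cast_nonneg _)
        exact hsum'.sum_le_tsum _ fun i _ => by positivity

lemma prod_facts (b : ℕ → ℕ) (hb : ∀ i, 2 ≤ b i)
    (hsum : Summable fun i => (1 : ℝ) / b i) :
    0 < ∏' i, (1 - 1 / (b i : ℝ)) ∧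
    Tendsto (fun k => ∏ i ∈ Finset.range k, (1 - 1 / (b i : ℝ))) atTop
      (nhds (∏' i, (1 - 1 / (b i : ℝ)))) := by
  have hpos : ∀ i, 0 < 1 - 1 / (b i : ℝ) := by
    intro i
    have : (2 : ℝ) ≤ b i := by exact_mod_cast hb i
    rw [sub_pos, div_lt_one (by linarith)]; linarith
  have hl : Summable fun i => Real.log (1 - 1 / (b i : ℝ)) := by
    have := Real.summable_log_one_add_of_summable hsum.neg
    simpa [sub_eq_add_neg] using this
  constructor
  · rw [← Real.rexp_tsum_eq_tprod hpos hl]; exact Real.exp_pos _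
  · exact (Real.multipliable_of_summable_log hpos hl).hasProd.tendsto_prod_nat

lemma density (b : ℕ → ℕ) (hb : ∀ i, 2 ≤ b i)
    (hcop : ∀ i j, i ≠ j → Nat.Coprime (b i) (b j))
    (hsum : Summable fun i => (1 : ℝ) / b i)
    (η : FullShift) (hη : ∀ m : ℤ, η m = 1 ↔ ∀ i, ¬ ((b i : ℤ) ∣ m)) (ν1 : ℝ)
    (h : Tendsto (fun N : ℕ => (((Finset.range N).filter fun s : ℕ => η (s : ℤ) = 1).card : ℝ) / N)
      atTop (nhds ν1)) : ∏' i, (1 - 1 / (b i : ℝ)) ≤ ν1 := by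
  classical
  have hT : Tendsto (fun k => ∑' i, (1 : ℝ) / b (i + k)) atTop (nhds 0) :=
    tendsto_sum_nat_add fun i => (1 : ℝ) / b i
  have key := ((prod_facts b hb hsum).2.sub hT)
  rw [sub_zero] at key
  refine le_of_tendsto' key fun k => ?_
  obtain ⟨C, hC⟩ := sieve b hb hcop k
  set D := ∏ i ∈ Finset.range k, (1 - 1 / (b i : ℝ))
  set T := ∑' i, (1 : ℝ) / b (i + k)
  have h0 : Tendsto (fun N : ℕ => D - T - (C + 1) / (N : ℝ)) atTop (nhds (D - T)) := by
    simpa using tendsto_const_nhds.sub (tendsto_const_div_atTop_nhds_zero_nat (C + 1))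
  refine le_of_tendsto_of_tendsto h0 h ?_
  filter_upwards [eventually_gt_atTop 0] with N hN
  have hNR : (0 : ℝ) < N := by exact_mod_cast hN
  rw [le_div_iff₀ hNR]
  have e : (D - T - (C + 1) / (N : ℝ)) * N = N * D - N * T - C - 1 := by
    field_simp; ring
  rw [e]
  have h1 := (abs_le.1 (hC N)).1
  have h2 := tail_count b hb hsum k N
  have h3 : ((Finset.range N).filter fun s => ∀ i < k, ¬ (b i ∣ s)).card ≤
      ((Finset.range N).filter fun s : ℕ => η (s : ℤ) = 1).card +
      ((Finset.range N).filter fun s => s ≠ 0 ∧ ∃ i ≥ k, b i ∣ s).card + 1 := by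
    have : ((Finset.range N).filter fun s => ∀ i < k, ¬ (b i ∣ s)) ⊆
      (((Finset.range N).filter fun s : ℕ => η (s : ℤ) = 1) ∪
      ((Finset.range N).filter fun s => s ≠ 0 ∧ ∃ i ≥ k, b i ∣ s)) ∪ {0} := by
      intro s hs
      simp only [Finset.mem_union, Finset.mem_filter, Finset.mem_range, Finset.mem_singleton] at *
      by_cases hs0 : s = 0
      · exact Or.inr hs0
      · left
        by_cases hx : ∃ i ≥ k, b i ∣ s
        · exact Or.inr ⟨hs.1, hs0, hx⟩
        · left
          refine ⟨hs.1, (hη s).2 fun i hd => ?_⟩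
          have hd' : b i ∣ s := by exact_mod_cast hd
          by_cases hi : i < k
          · exact hs.2 i hi hd'
          · exact hx ⟨i, by omega, hd'⟩
    refine (Finset.card_le_card this).trans ((Finset.card_union_le _ _).trans ?_)
    have := Finset.card_union_le ((Finset.range N).filter fun s : ℕ => η (s : ℤ) = 1)
      ((Finset.range N).filter fun s => s ≠ 0 ∧ ∃ i ≥ k, b i ∣ s)
    simp only [Finset.card_singleton]
    omega
  have h3R : (((Finset.range N).filter fun s => ∀ i < k, ¬ (b i ∣ s)).card : ℝ) ≤
      ((Finset.range N).filter fun s : ℕ => η (s : ℤ) = 1).card +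
      ((Finset.range N).filter fun s => s ≠ 0 ∧ ∃ i ≥ k, b i ∣ s).card + 1 := by
    exact_mod_cast h3
  linarith

/-- an occurrence pair at bounded distance gives a contradiction -/
lemma exists_coprime (b : ℕ → ℕ) (hcop : ∀ i j, i ≠ j → Nat.Coprime (b i) (b j)) (H : ℕ) :
    ∃ j, ∀ h, 0 < h → h ≤ H → Nat.Coprime h (b j) := by
  by_contra! hcon
  choose h h1 h2 h3 using hcon
  have hq : ∀ j, (Nat.gcd (h j) (b j)).minFac.Prime := fun j => Nat.minFac_prime (h3 j)
  have hqh : ∀ j, (Nat.gcd (h j) (b j)).minFac ∣ h j := fun j =>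
    (Nat.minFac_dvd _).trans (Nat.gcd_dvd_left _ _)
  have hqb : ∀ j, (Nat.gcd (h j) (b j)).minFac ∣ b j := fun j =>
    (Nat.minFac_dvd _).trans (Nat.gcd_dvd_right _ _)
  have hle : ∀ j, (Nat.gcd (h j) (b j)).minFac < H + 1 := fun j =>
    Nat.lt_succ_of_le ((Nat.le_of_dvd (h1 j) (hqh j)).trans (h2 j))
  refine not_injective_infinite_finite
    (fun j => (⟨(Nat.gcd (h j) (b j)).minFac, hle j⟩ : Fin (H + 1))) ?_
  intro i j hij
  by_contra hne
  have e : (Nat.gcd (h i) (b i)).minFac = (Nat.gcd (h j) (b j)).minFac := by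
    simpa using hij
  exact Nat.not_coprime_of_dvd_of_dvd (hq i).one_lt (hqb i) (e ▸ hqb j) (hcop i j hne)

lemma no_period (b : ℕ → ℕ) (hb : ∀ i, 2 ≤ b i)
    (η : FullShift) (hη : ∀ m : ℤ, η m = 1 ↔ ∀ i, ¬ ((b i : ℤ) ∣ m))
    (j h n s i0 : ℕ) (hh : 0 < h) (hc : Nat.Coprime h (b j)) (hn : h * b j ≤ n)
    (hper : ∀ i, i + h < n → η ((s + i : ℕ) : ℤ) = η ((s + h + i : ℕ) : ℤ))
    (hi0 : i0 < n) (h1 : η ((s + i0 : ℕ) : ℤ) = 1) : False := by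
  have hper' : ∀ r t, r + h * t < n → η ((s + (r + h * t) : ℕ) : ℤ) = η ((s + r : ℕ) : ℤ) := by
    intro r t
    induction t with
    | zero => simp
    | succ t ih =>
      intro hlt
      have e : r + h * (t + 1) = r + h * t + h := by ring
      rw [e] at hlt
      rw [← ih (by omega), hper _ hlt]
      congr 2
      rw [e]; ring
  set r := i0 % h with hr
  have hr1 : η ((s + r : ℕ) : ℤ) = 1 := by
    rw [← hper' r (i0 / h) (by rw [hr, Nat.mod_add_div]; exact hi0), hr, Nat.mod_add_div, h1]
  have hbj : 0 < b j := by have := hb j; omega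
  have : NeZero (b j) := ⟨hbj.ne'⟩
  set t := (-((s + r : ℕ) : ZMod (b j)) * ((h : ZMod (b j))⁻¹)).val with ht
  have htl : t < b j := ZMod.val_lt _
  have hrh : r < h := Nat.mod_lt _ hh
  have hlt : r + h * t < n := by
    have : h * (t + 1) ≤ h * b j := Nat.mul_le_mul_left _ htl
    rw [mul_add] at this
    omega
  have h2 : η ((s + (r + h * t) : ℕ) : ℤ) = 1 := by rw [hper' r t hlt, hr1]
  refine (hη _).1 h2 j ?_
  have : ((s + (r + h * t) : ℕ) : ZMod (b j)) = 0 := by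
    have hu : (h : ZMod (b j)) * (h : ZMod (b j))⁻¹ = 1 := ZMod.coe_mul_inv_eq_one h hc
    push_cast
    rw [ht, ZMod.natCast_zmod_val]
    push_cast
    linear_combination (-((s : ZMod (b j)) + r)) * hu
  exact_mod_cast (ZMod.natCast_eq_zero_iff _ _).1 this

lemma close_pair (S : ℕ → Prop) [DecidablePred S] (l : ℝ) (H : ℕ) (hH : 0 < H)
    (hδ : 1 / (H : ℝ) < l)
    (h : Tendsto (fun N : ℕ => (((Finset.range N).filter S).card : ℝ) / N) atTop (nhds l)) :
    ∃ s h, 0 < h ∧ h ≤ H ∧ S s ∧ S (s + h) := by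
  have h0 : Tendsto (fun N : ℕ => 1 / (H : ℝ) + 1 / (N : ℝ)) atTop (nhds (1 / (H : ℝ))) := by
    simpa using tendsto_const_nhds.add (tendsto_const_div_atTop_nhds_zero_nat (1 : ℝ))
  obtain ⟨N, hN, hN0⟩ := ((h0.eventually_lt h hδ).and (eventually_gt_atTop 0)).exists
  have hNR : (0 : ℝ) < N := by exact_mod_cast hN0
  have hHR : (0 : ℝ) < H := by exact_mod_cast hH
  rw [lt_div_iff₀ hNR] at hN
  have e : (1 / (H : ℝ) + 1 / (N : ℝ)) * N = N / H + 1 := by field_simp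
  rw [e] at hN
  have hcard : N / H + 1 < ((Finset.range N).filter S).card := by
    have : ((N / H : ℕ) : ℝ) ≤ N / H := Nat.cast_div_le
    have : ((N / H + 1 : ℕ) : ℝ) < ((Finset.range N).filter S).card := by push_cast; linarith
    exact_mod_cast this
  obtain ⟨x, hx, y, hy, hxy, he⟩ := Finset.exists_ne_map_eq_of_card_lt_of_maps_to
    (t := Finset.range (N / H + 1)) (f := fun s => s / H) (by simpa using hcard) (by
      intro s hs
      have hs := (Finset.mem_filter.1 hs).1
      rw [Finset.mem_range] at hs
      simp only [Finset.coe_range, Set.mem_Iio]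
      exact Nat.lt_succ_of_le (Nat.div_le_div_right hs.le))
  have hx := (Finset.mem_filter.1 hx).2
  have hy := (Finset.mem_filter.1 hy).2
  have ex := Nat.mod_add_div x H
  have ey := Nat.mod_add_div y H
  have mx := Nat.mod_lt x hH
  have my := Nat.mod_lt y hH
  rw [he] at ex
  rcases lt_or_gt_of_ne hxy with hlt | hlt
  · exact ⟨x, y - x, by omega, by omega, hx, by rwa [Nat.add_sub_cancel' hlt.le]⟩
  · exact ⟨y, x - y, by omega, by omega, hy, by rwa [Nat.add_sub_cancel' hlt.le]⟩

lemma ones_eq_sum {n : ℕ} (W : Fin n → Fin 2) :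
    (ones W : ℝ) = ∑ i, if W i = 1 then (1 : ℝ) else 0 := by
  simp [ones]

open Classical in
lemma sum_freq (η : FullShift) (n N : ℕ) (g : (Fin n → Fin 2) → ℝ) :
    ∑ W, (freqCount η W N : ℝ) * g W = ∑ s ∈ Finset.range N, g (wordAt (shift^[s] η) n) := by
  have : ∀ W : Fin n → Fin 2, (freqCount η W N : ℝ) * g W
      = ∑ s ∈ Finset.range N, if wordAt (shift^[s] η) n = W then g W else 0 := by
    intro W
    simp only [freqCount, mem_cyl_iter]
    rw [← Finset.sum_filter, Finset.sum_const, nsmul_eq_mul]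
  simp_rw [this]
  rw [Finset.sum_comm]
  simp

lemma freq_one (η : FullShift) (N : ℕ) :
    freqCount η (fun _ : Fin 1 => (1 : Fin 2)) N
      = ((Finset.range N).filter fun s : ℕ => η (s : ℤ) = 1).card := by
  classical
  unfold freqCount
  congr 1
  ext s
  simp [mem_cyl_iter, funext_iff, wordAt, shift_iter]

lemma count_shift (η : FullShift) (N i : ℕ) :
    (((Finset.range N).filter fun s : ℕ => η (s : ℤ) = 1).card : ℝ) - i ≤
      ∑ s ∈ Finset.range N, if η ((i + s : ℕ) : ℤ) = 1 then (1 : ℝ) else 0 := by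
  set f : ℕ → ℝ := fun s => if η (s : ℤ) = 1 then (1 : ℝ) else 0 with hf
  have h1 : (((Finset.range N).filter fun s : ℕ => η (s : ℤ) = 1).card : ℝ)
      = ∑ s ∈ Finset.range N, f s := by simp [hf]
  have h2 := Finset.sum_range_add f i N
  have h3 : ∑ s ∈ Finset.range N, f s ≤ ∑ s ∈ Finset.range (i + N), f s :=
    Finset.sum_le_sum_of_subset_of_nonneg
      (Finset.range_subset_range.2 (by omega)) (fun s _ _ => by simp only [hf]; split_ifs <;> norm_num)
  have h4 : ∑ s ∈ Finset.range i, f s ≤ i := by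
    calc _ ≤ ∑ s ∈ Finset.range i, (1 : ℝ) :=
          Finset.sum_le_sum fun s _ => by simp only [hf]; split_ifs <;> norm_num
      _ = i := by simp
  have h5 : (∑ s ∈ Finset.range N, if η ((i + s : ℕ) : ℤ) = 1 then (1 : ℝ) else 0)
      = ∑ s ∈ Finset.range N, f (i + s) := rfl
  rw [h1, h5]; linarith

lemma avg (η : FullShift) (v : (n : ℕ) → (Fin n → Fin 2) → ℝ) (hv0 : ∀ n W, 0 ≤ v n W)
    (hgen : ∀ (k : ℕ) (W : Fin k → Fin 2),
      Tendsto (fun n : ℕ => (freqCount η W n : ℝ) / n) atTop (nhds (v k W)))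
    (d : ℝ) (hd : d ≤ v 1 (fun _ => 1)) (n : ℕ) :
    ∃ W : Fin n → Fin 2, 0 < v n W ∧ n * d ≤ ones W := by
  by_contra! hcon
  have hlim : ∀ g : (Fin n → Fin 2) → ℝ,
      Tendsto (fun N : ℕ => (∑ s ∈ Finset.range N, g (wordAt (shift^[s] η) n)) / (N : ℝ)) atTop
        (nhds (∑ W, v n W * g W)) := by
    intro g
    have : Tendsto (fun N : ℕ => ∑ W, (freqCount η W N : ℝ) / N * g W) atTop
        (nhds (∑ W, v n W * g W)) :=
      tendsto_finsetSum _ fun W _ => (hgen n W).mul_const _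
    refine this.congr fun N => ?_
    rw [← sum_freq, Finset.sum_div]
    exact Finset.sum_congr rfl fun W _ => by ring
  have hone : ∑ W, v n W = 1 := by
    have h := hlim fun _ => 1
    simp only [mul_one, Finset.sum_const, Finset.card_range, nsmul_eq_mul] at h
    refine tendsto_nhds_unique h (tendsto_const_nhds.congr' ?_)
    filter_upwards [eventually_gt_atTop 0] with N hN
    have : (N : ℝ) ≠ 0 := by exact_mod_cast hN.ne'
    field_simp
  have hge : n * d ≤ ∑ W, v n W * ones W := by
    have hl := hlim fun W => (ones W : ℝ)
    have h1 := hgen 1 (fun _ => 1)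
    have h2 : Tendsto (fun N : ℕ => (n : ℝ) * ((freqCount η (fun _ : Fin 1 => (1 : Fin 2)) N : ℝ) / N)
        - (n * n : ℝ) / N) atTop (nhds (n * v 1 (fun _ => 1))) := by
      simpa using (h1.const_mul (n : ℝ)).sub (tendsto_const_div_atTop_nhds_zero_nat (n * n : ℝ))
    have h3 : n * v 1 (fun _ => 1) ≤ ∑ W, v n W * ones W := by
      refine le_of_tendsto_of_tendsto h2 hl ?_
      filter_upwards [eventually_gt_atTop 0] with N hN
      have hNR : (0 : ℝ) < N := by exact_mod_cast hN
      rw [freq_one, le_div_iff₀ hNR]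
      have e : ∀ c : ℝ, ((n : ℝ) * (c / N) - (n * n : ℝ) / N) * N = n * c - n * n := by
        intro c; field_simp
      rw [e]
      simp_rw [ones_eq_sum]
      rw [Finset.sum_comm]
      calc _ = ∑ i : Fin n, ((((Finset.range N).filter fun s : ℕ => η (s : ℤ) = 1).card : ℝ) - n) := by
            simp [mul_sub]
        _ ≤ _ := by
            refine Finset.sum_le_sum fun i _ => ?_
            have hc := count_shift η N i
            have hi : ((i : ℕ) : ℝ) ≤ n := by exact_mod_cast i.2.le
            have e2 : (∑ s ∈ Finset.range N, if wordAt (shift^[s] η) n i = 1 then (1 : ℝ) else 0)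
              = ∑ s ∈ Finset.range N, if η (((i : ℕ) + s : ℕ) : ℤ) = 1 then (1 : ℝ) else 0 := by
              refine Finset.sum_congr rfl fun s _ => ?_
              simp [wordAt, shift_iter]
            rw [e2]; linarith
    exact (mul_le_mul_of_nonneg_left hd (Nat.cast_nonneg n)).trans h3
  have hsum0 : 0 ≤ ∑ W, v n W * ((ones W : ℝ) - n * d) := by
    simp_rw [mul_sub]
    rw [Finset.sum_sub_distrib, ← Finset.sum_mul, hone]; linarith
  have hle : ∀ W ∈ Finset.univ, v n W * ((ones W : ℝ) - n * d) ≤ 0 := by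
    intro W _
    rcases (hv0 n W).eq_or_lt with h | h
    · rw [← h]; simp
    · exact mul_nonpos_of_nonneg_of_nonpos h.le (by linarith [hcon W h])
  have hz := (Finset.sum_eq_zero_iff_of_nonpos hle).1
    (le_antisymm (Finset.sum_nonpos hle) hsum0)
  have : ∑ W, v n W = 0 := by
    refine Finset.sum_eq_zero fun W _ => ?_
    by_contra hne
    have hpos : 0 < v n W := lt_of_le_of_ne (hv0 n W) (Ne.symm hne)
    rcases mul_eq_zero.1 (hz W (Finset.mem_univ _)) with h | h
    · exact hne h
    · linarith [hcon W hpos]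
  linarith

lemma meas_cyl {n : ℕ} (W : Fin n → Fin 2) : MeasurableSet (_root_.cylinder W) := by
  have : _root_.cylinder W = ⋂ i : Fin n, (fun x : FullShift => x ((i : ℕ) : ℤ)) ⁻¹' {W i} := by
    ext x
    rw [Set.mem_iInter]
    exact Iff.rfl
  rw [this]
  exact MeasurableSet.iInter fun i => measurable_pi_apply _ (measurableSet_singleton _)

lemma meas_Q : Measurable Qmul := by
  refine measurable_pi_lambda _ fun i => ?_
  have m : Measurable (fun q : Fin 2 × Fin 2 => q.1 * q.2) := Measurable.of_discrete
  have g : Measurable (fun q : FullShift × FullShift => (q.1 i, q.2 i)) :=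
    ((measurable_pi_apply i).comp measurable_fst).prodMk
      ((measurable_pi_apply i).comp measurable_snd)
  exact m.comp g

lemma fin2_mul {a b c : Fin 2} (h : a * b = c) (hc : c = 1) : a = 1 ∧ b = 1 := by
  revert a b c; decide

lemma B_ge (B : Measure FullShift) [IsProbabilityMeasure B] (p : ℝ)
    (hB : ∀ (n : ℕ) (W : Fin n → Fin 2),
      (B (_root_.cylinder W)).toReal = p ^ zeros W * (1 - p) ^ ones W)
    {n : ℕ} (W : Fin n → Fin 2) :
    (B {y | ∀ i : Fin n, W i = 1 → y ((i : ℕ) : ℤ) = 1}).toReal ≤ (1 - p) ^ ones W := by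
  classical
  set t : Fin n → Finset (Fin 2) := fun i => if W i = 1 then {1} else Finset.univ with ht
  have hsub : {y : FullShift | ∀ i : Fin n, W i = 1 → y ((i : ℕ) : ℤ) = 1} ⊆
      ⋃ V ∈ Fintype.piFinset t, _root_.cylinder V := by
    intro y hy
    rw [Set.mem_iUnion₂]
    refine ⟨wordAt y n, ?_, fun i => rfl⟩
    rw [Fintype.mem_piFinset]
    intro i
    simp only [ht]
    split_ifs with h
    · rw [Finset.mem_singleton]; exact hy i h
    · simp
  calc _ ≤ B.real (⋃ V ∈ Fintype.piFinset t, _root_.cylinder V) := measureReal_mono hsub (measure_ne_top _ _)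
    _ ≤ ∑ V ∈ Fintype.piFinset t, B.real (_root_.cylinder V) := measureReal_biUnion_finset_le _ _
    _ = ∑ V ∈ Fintype.piFinset t, ∏ i, (if V i = 0 then p else 1 - p) := by
        refine Finset.sum_congr rfl fun V _ => ?_
        rw [Measure.real, hB, Finset.prod_ite, Finset.prod_const, Finset.prod_const]
        congr 3
        unfold ones
        congr 1
        ext i
        simp only [Finset.mem_filter, Finset.mem_univ, true_and]
        generalize V i = u
        revert u; decide
    _ = ∏ i, ∑ u ∈ t i, (if u = 0 then p else 1 - p) := by
        rw [Finset.prod_univ_sum]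
    _ = ∏ i, (if W i = 1 then 1 - p else 1) := by
        refine Finset.prod_congr rfl fun i _ => ?_
        simp only [ht]
        split_ifs <;> simp
    _ = (1 - p) ^ ones W := by
        rw [Finset.prod_ite]; simp [ones]
    _ ≤ _ := le_rfl

lemma ones_lt {n : ℕ} (W V : Fin n → Fin 2) (h : ∀ i, W i = 1 → V i = 1) (hne : V ≠ W) :
    ones W < ones V := by
  unfold ones
  refine Finset.card_lt_card ⟨fun i => by simpa using h i, fun hs => hne ?_⟩
  ext1 i
  have h1 := h i
  have h2 : V i = 1 → W i = 1 := fun hh => by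
    have := hs (Finset.mem_filter.2 ⟨Finset.mem_univ i, hh⟩)
    exact (Finset.mem_filter.1 this).2
  revert h1 h2
  generalize V i = u
  generalize W i = w
  revert u w
  decide

lemma kappa_le (ν B : Measure FullShift) [IsProbabilityMeasure ν] [IsProbabilityMeasure B] (p : ℝ)
    (hB : ∀ (n : ℕ) (W : Fin n → Fin 2),
      (B (_root_.cylinder W)).toReal = p ^ zeros W * (1 - p) ^ ones W)
    {n : ℕ} (W : Fin n → Fin 2)
    (hmax : ∀ V : Fin n → Fin 2, ones W < ones V → ν (_root_.cylinder V) = 0) :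
    (((ν.prod B).map Qmul) (_root_.cylinder W)).toReal
      ≤ (ν (_root_.cylinder W)).toReal * (1 - p) ^ ones W := by
  classical
  rw [Measure.map_apply meas_Q (meas_cyl W)]
  set E : Set FullShift := {y | ∀ i : Fin n, W i = 1 → y ((i : ℕ) : ℤ) = 1} with hE
  have hnull : ν (⋃ V ∈ {V : Fin n → Fin 2 | ones W < ones V}, _root_.cylinder V) = 0 :=
    (measure_biUnion_null_iff (Set.to_countable _)).2 hmax
  have hsub : Qmul ⁻¹' _root_.cylinder W ⊆ (_root_.cylinder W ×ˢ E) ∪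
      ((⋃ V ∈ {V : Fin n → Fin 2 | ones W < ones V}, _root_.cylinder V) ×ˢ Set.univ) := by
    rintro ⟨x, y⟩ hxy
    have hxy' : ∀ i : Fin n, x ((i : ℕ) : ℤ) * y ((i : ℕ) : ℤ) = W i := hxy
    by_cases h : wordAt x n = W
    · left
      exact ⟨fun i => congrFun h i, fun i hi => (fin2_mul (hxy' i) hi).2⟩
    · right
      refine ⟨?_, trivial⟩
      rw [Set.mem_iUnion₂]
      exact ⟨wordAt x n, ones_lt W _ (fun i hi => (fin2_mul (hxy' i) hi).1) h, fun i => rfl⟩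
  have hle : (ν.prod B) (Qmul ⁻¹' _root_.cylinder W) ≤ ν (_root_.cylinder W) * B E := by
    refine (measure_mono hsub).trans ((measure_union_le _ _).trans ?_)
    rw [Measure.prod_prod, Measure.prod_prod, hnull, zero_mul, add_zero]
  calc _ ≤ (ν (_root_.cylinder W) * B E).toReal :=
        ENNReal.toReal_mono (ENNReal.mul_ne_top (measure_ne_top _ _) (measure_ne_top _ _)) hle
    _ = (ν (_root_.cylinder W)).toReal * (B E).toReal := ENNReal.toReal_mul
    _ ≤ _ := mul_le_mul_of_nonneg_left (B_ge B p hB W) ENNReal.toReal_nonneg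

lemma kappa_pos (ν B : Measure FullShift) [IsProbabilityMeasure ν] [IsProbabilityMeasure B] (p : ℝ)
    (hp0 : 0 < p) (hp1 : p < 1)
    (hB : ∀ (n : ℕ) (W : Fin n → Fin 2),
      (B (_root_.cylinder W)).toReal = p ^ zeros W * (1 - p) ^ ones W)
    {n : ℕ} (W : Fin n → Fin 2) (hW : 0 < (ν (_root_.cylinder W)).toReal) :
    0 < ((ν.prod B).map Qmul) (_root_.cylinder W) := by
  rw [Measure.map_apply meas_Q (meas_cyl W)]
  have hsub : _root_.cylinder W ×ˢ _root_.cylinder W ⊆ Qmul ⁻¹' _root_.cylinder W := by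
    rintro ⟨x, y⟩ ⟨hx, hy⟩ i
    have h1 : x ((i : ℕ) : ℤ) = W i := hx i
    have h2 : y ((i : ℕ) : ℤ) = W i := hy i
    change x ((i : ℕ) : ℤ) * y ((i : ℕ) : ℤ) = W i
    rw [h1, h2]
    generalize W i = u
    revert u; decide
  refine lt_of_lt_of_le ?_ (measure_mono hsub)
  rw [Measure.prod_prod]
  have hBW : 0 < (B (_root_.cylinder W)).toReal := by
    rw [hB]
    have : 0 < 1 - p := by linarith
    positivity
  exact ENNReal.mul_pos (ENNReal.toReal_pos_iff.1 hW).1.ne' (ENNReal.toReal_pos_iff.1 hBW).1.ne'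

lemma birk (x : FullShift) (hx : ∀ m : ℤ, x m = 1 → x (m + 1) ≠ 1) (a00 a01 a1 : ℝ) (n : ℕ) :
    n * a00 + ones (wordAt x n) * (a1 + a01 - 2 * a00) - |a01 - a00|
      ≤ birkhoff (phi012 a00 a01 a1) n x := by
  set f : ℕ → ℝ := fun s => if x (s : ℤ) = 1 then (1 : ℝ) else 0 with hf
  have h1 : ∀ s : ℕ, phi012 a00 a01 a1 (shift^[s] x)
      = a00 + f s * (a1 - a00) + f (s + 1) * (a01 - a00) := by
    intro s
    simp only [phi012, shift_iter, hf]
    have e : ((1 : ℤ) + (s : ℤ)) = ((s + 1 : ℕ) : ℤ) := by push_cast; ring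
    have hs := hx s
    have e' : ((s : ℤ) + 1) = ((s + 1 : ℕ) : ℤ) := by push_cast; ring
    rw [e'] at hs
    rw [e, zero_add]
    generalize x ((s + 1 : ℕ) : ℤ) = u at *
    generalize x (s : ℤ) = w at *
    fin_cases u <;> fin_cases w <;> simp at hs ⊢
  have h2 : ∑ s ∈ Finset.range n, f (s + 1) = ∑ s ∈ Finset.range n, f s + f n - f 0 := by
    have := Finset.sum_range_succ f n
    have := Finset.sum_range_succ' f n
    linarith
  have h3 : (ones (wordAt x n) : ℝ) = ∑ s ∈ Finset.range n, f s := by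
    rw [ones_eq_sum, Finset.sum_range]
    rfl
  have h4 : birkhoff (phi012 a00 a01 a1) n x = n * a00 + ones (wordAt x n) * (a1 + a01 - 2 * a00)
      + (f n - f 0) * (a01 - a00) := by
    unfold birkhoff
    simp_rw [h1]
    rw [Finset.sum_add_distrib, Finset.sum_add_distrib, ← Finset.sum_mul, ← Finset.sum_mul, h2, h3]
    simp
    ring
  rw [h4]
  have h5 : |(f n - f 0) * (a01 - a00)| ≤ |a01 - a00| := by
    rw [abs_mul]
    refine mul_le_of_le_one_left (abs_nonneg _) ?_
    simp only [hf]
    split_ifs <;> norm_num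
  linarith [(abs_le.1 h5).1]

end S17

open Classical in
theorem stmt17 (b : ℕ → ℕ) (hb : ∀ i, 2 ≤ b i)
    (hcop : ∀ i j, i ≠ j → Nat.Coprime (b i) (b j))
    (hsum : Summable fun i => (1 : ℝ) / b i) (h2 : b 0 = 2)
    (η : FullShift) (hη : ∀ m : ℤ, η m = 1 ↔ ∀ i, ¬ ((b i : ℤ) ∣ m))
    (ν B : Measure FullShift) [IsProbabilityMeasure ν] [IsProbabilityMeasure B]
    -- ν is the Mirsky measure: η is a generic point for ν
    (hgen : ∀ (k : ℕ) (W : Fin k → Fin 2),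
      Tendsto (fun n : ℕ => (freqCount η W n : ℝ) / n) atTop
        (nhds ((ν (cylinder W)).toReal)))
    (a00 a01 a1 : ℝ) (ha1 : max a00 a01 ≤ a1) (ha2 : 2 * a00 ≤ a1 + a01)
    (p : ℝ) (hp : p = (2 : ℝ) ^ (2 * a00) / ((2 : ℝ) ^ (a1 + a01) + (2 : ℝ) ^ (2 * a00)))
    (hB : ∀ (n : ℕ) (W : Fin n → Fin 2),
      (B (cylinder W)).toReal = p ^ zeros W * (1 - p) ^ ones W)
    (d P : ℝ) (hd : d = ∏' i, (1 - 1 / (b i : ℝ)))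
    (hP : P = a00 * (1 - 2 * d) +
      d * Real.logb 2 ((2 : ℝ) ^ (a1 + a01) + (2 : ℝ) ^ (2 * a00))) :
    ¬ IsGibbs (XB b) ((ν.prod B).map Qmul) (phi012 a00 a01 a1) P := by 
  rintro ⟨c, hc, hG⟩
  have hA : (0 : ℝ) < (2 : ℝ) ^ (a1 + a01) := Real.rpow_pos_of_pos two_pos _
  have hD : (0 : ℝ) < (2 : ℝ) ^ (2 * a00) := Real.rpow_pos_of_pos two_pos _
  have hp0 : 0 < p := by rw [hp]; positivity
  have hp1' : 1 - p = (2 : ℝ) ^ (a1 + a01) / ((2 : ℝ) ^ (a1 + a01) + (2 : ℝ) ^ (2 * a00)) := by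
    rw [hp]; field_simp; ring
  have hq0 : 0 < 1 - p := by rw [hp1']; positivity
  have hp1 : p < 1 := by linarith
  have hd0 : 0 < d := by rw [hd]; exact (S17.prod_facts b hb hsum).1
  have hdν : d ≤ (ν (_root_.cylinder (fun _ : Fin 1 => (1 : Fin 2)))).toReal := by
    rw [hd]
    refine S17.density b hb hcop hsum η hη _ ((hgen 1 (fun _ => 1)).congr fun N => ?_)
    rw [S17.freq_one]
  set K : ℝ := (2 : ℝ) ^ (-|a01 - a00|) with hK
  have hK0 : 0 < K := Real.rpow_pos_of_pos two_pos _
  have hδ : 0 < c⁻¹ * K := by positivity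
  obtain ⟨H', hH'⟩ := exists_nat_one_div_lt hδ
  set H := H' + 1 with hH
  have hH1 : 1 / (H : ℝ) < c⁻¹ * K := by rw [hH]; push_cast; exact hH'
  obtain ⟨j, hj⟩ := S17.exists_coprime b hcop H
  have hbj : 0 < b j := by have := hb j; omega
  set n := H * b j with hn
  have hn0 : 0 < n := Nat.mul_pos (by omega) hbj
  obtain ⟨W0, hW0, hW0d⟩ := S17.avg η (fun k W => (ν (_root_.cylinder W)).toReal)
    (fun _ _ => ENNReal.toReal_nonneg) hgen d hdν n
  obtain ⟨W, hWm, hWmax⟩ := Finset.exists_max_image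
    (Finset.univ.filter fun W : Fin n → Fin 2 => 0 < (ν (_root_.cylinder W)).toReal) ones
    ⟨W0, Finset.mem_filter.2 ⟨Finset.mem_univ _, hW0⟩⟩
  have hWpos : 0 < (ν (_root_.cylinder W)).toReal := (Finset.mem_filter.1 hWm).2
  have hWd : n * d ≤ ones W :=
    hW0d.trans (by exact_mod_cast hWmax W0 (Finset.mem_filter.2 ⟨Finset.mem_univ _, hW0⟩))
  have hmax : ∀ V : Fin n → Fin 2, ones W < ones V → ν (_root_.cylinder V) = 0 := by
    intro V hV
    by_contra hne
    have := hWmax V (Finset.mem_filter.2 ⟨Finset.mem_univ _,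
      ENNReal.toReal_pos hne (measure_ne_top _ _)⟩)
    omega
  have hgW := hgen n W
  -- an occurrence
  obtain ⟨H2, hH2⟩ := exists_nat_one_div_lt hWpos
  obtain ⟨s0, -, -, -, hs0, -⟩ := S17.close_pair (fun s => shift^[s] η ∈ _root_.cylinder W) _ (H2 + 1)
    (Nat.succ_pos _) (by push_cast; exact hH2) hgW
  rw [S17.mem_cyl_iter] at hs0
  set x := shift^[s0] η with hx
  have hxX : x ∈ XB b := by
    intro i
    refine ⟨-(s0 : ZMod (b i)), fun m hm he => ?_⟩
    rw [hx, S17.shift_iter] at hm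
    refine (hη _).1 hm i ?_
    rw [← ZMod.intCast_zmod_eq_zero_iff_dvd]
    push_cast
    rw [he]; ring
  have hxx : ∀ m : ℤ, x m = 1 → x (m + 1) ≠ 1 := by
    intro m h1 h1'
    rw [hx, S17.shift_iter] at h1 h1'
    have e1 := (hη _).1 h1 0
    have e2 := (hη _).1 h1' 0
    rw [h2] at e1 e2
    push_cast at e1 e2
    omega
  have hκpos := S17.kappa_pos ν B p hp0 hp1 hB W hWpos
  have hκle := S17.kappa_le ν B p hB W hmax
  have hlow := (hG n x hxX (by rw [hs0]; exact hκpos)).1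
  rw [hs0] at hlow
  have hbk := S17.birk x hxx a00 a01 a1 n
  rw [hs0] at hbk
  set k := ones W with hk
  -- the weight
  have hwt : K * (1 - p) ^ k ≤ (2 : ℝ) ^ (birkhoff (phi012 a00 a01 a1) n x - n * P) := by
    set L := Real.logb 2 ((2 : ℝ) ^ (a1 + a01) + (2 : ℝ) ^ (2 * a00)) with hL
    have h2L : (2 : ℝ) ^ L = (2 : ℝ) ^ (a1 + a01) + (2 : ℝ) ^ (2 * a00) :=
      Real.rpow_logb two_pos (by norm_num) (by positivity)
    have hq : 1 - p = (2 : ℝ) ^ (a1 + a01 - L) := by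
      rw [hp1', ← h2L, ← Real.rpow_sub two_pos]
    have hpL : p = (2 : ℝ) ^ (2 * a00 - L) := by
      rw [hp, ← h2L, ← Real.rpow_sub two_pos]
    have hLge : 2 * a00 - L ≤ 0 := by
      by_contra! hcon
      have := Real.one_lt_rpow (x := 2) one_lt_two hcon
      rw [← hpL] at this
      linarith
    rw [hq, hK, ← Real.rpow_natCast, ← Real.rpow_mul two_pos.le, ← Real.rpow_add two_pos]
    refine Real.rpow_le_rpow_of_exponent_le one_le_two ?_
    rw [hP]
    have := mul_nonneg_of_nonpos_of_nonpos hLge (sub_nonpos.2 hWd)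
    nlinarith
  have hν : c⁻¹ * K ≤ (ν (_root_.cylinder W)).toReal := by
    have hwpos : 0 < (2 : ℝ) ^ (birkhoff (phi012 a00 a01 a1) n x - n * P) :=
      Real.rpow_pos_of_pos two_pos _
    rw [le_div_iff₀ hwpos] at hlow
    have hqk : 0 < (1 - p) ^ k := pow_pos hq0 _
    refine le_of_mul_le_mul_right ?_ hqk
    calc c⁻¹ * K * (1 - p) ^ k = c⁻¹ * (K * (1 - p) ^ k) := by ring
      _ ≤ c⁻¹ * (2 : ℝ) ^ (birkhoff (phi012 a00 a01 a1) n x - n * P) :=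
          mul_le_mul_of_nonneg_left hwt (by positivity)
      _ ≤ _ := hlow.trans hκle
  obtain ⟨s, h, hh0, hhH, hs, hsh⟩ := S17.close_pair
    (fun s => shift^[s] η ∈ _root_.cylinder W) _ H (by omega) (hH1.trans_le hν) hgW
  have hs' : ∀ i : Fin n, η ((s + (i : ℕ) : ℕ) : ℤ) = W i := by
    intro i
    have := hs i
    rw [S17.shift_iter] at this
    rw [← this]; congr 1; push_cast; ring
  have hsh' : ∀ i : Fin n, η ((s + h + (i : ℕ) : ℕ) : ℤ) = W i := by
    intro i
    have := hsh i
    rw [S17.shift_iter] at this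
    rw [← this]; congr 1; push_cast; ring
  have hk0 : 0 < k := by
    have : (0 : ℝ) < n * d := mul_pos (by exact_mod_cast hn0) hd0
    exact_mod_cast this.trans_le hWd
  obtain ⟨i0, hi0⟩ := Finset.card_pos.1 hk0
  have hi0 := (Finset.mem_filter.1 hi0).2
  refine S17.no_period b hb η hη j h n s i0 hh0 (hj h hh0 hhH)
    (Nat.mul_le_mul_right _ hhH) ?_ i0.2 (by rw [hs', hi0])
  intro i hi
  rw [hs' ⟨i, by omega⟩, hsh' ⟨i, by omega⟩]
end

section
/- Suppose B is infinite, pairwise coprime, Σ1/b < ∞, and 2 ∈ B. For φ = a₀₀·1_{[00]} + a₀₁·1_{[01]} + a₁·1_{[1]} and p = 2^{2a₀₀}/(2^{a₁+a₀₁} + 2^{2a₀₀}), the measure ν_η ∗ B_{p,1−p} is an equilibrium state for φ on (X_η, S): h_{ν_η∗B_{p,1−p}}(X_η,S) + ∫φ d(ν_η∗B_{p,1−p}) = P(X_η, φ). -/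
open Filter MeasureTheory

/-- The n-th entropy sum H_μ(L_n) = -Σ_W μ(W) log₂ μ(W) (with 0·log₂ 0 = 0). -/
noncomputable def Hn (μ : Measure FullShift) (n : ℕ) : ℝ :=
  -∑ W : Fin n → Fin 2, (μ (cylinder W)).toReal * Real.logb 2 ((μ (cylinder W)).toReal)

namespace BF

lemma card_mul (P : ℕ → Prop) [DecidablePred P] (N : ℕ) (hP : Function.Periodic P N) (s k : ℕ) :
    ((Finset.Ico s (s + N * k)).filter P).card = k * Nat.count P N := by
  induction k with
  | zero => simp
  | succ k ih =>
    have h1 : Finset.Ico s (s + N * (k + 1)) =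
        Finset.Ico s (s + N * k) ∪ Finset.Ico (s + N * k) (s + N * k + N) := by
      rw [Finset.Ico_union_Ico_eq_Ico (by omega) (by omega)]
      congr 1
      ring
    rw [h1, Finset.filter_union, Finset.card_union_of_disjoint, ih,
      Nat.filter_Ico_card_eq_of_periodic _ _ _ hP]
    · ring
    · apply Finset.disjoint_filter_filter
      exact Finset.Ico_disjoint_Ico_consecutive _ _ _

lemma card_le (P : ℕ → Prop) [DecidablePred P] (N : ℕ) (hN : 0 < N)
    (hP : Function.Periodic P N) (s n : ℕ) :
    ((Finset.Ico s (s + n)).filter P).card ≤ (n / N + 1) * Nat.count P N := by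
  rw [← card_mul P N hP s]
  apply Finset.card_le_card
  apply Finset.filter_subset_filter
  apply Finset.Ico_subset_Ico le_rfl
  have := Nat.lt_mul_div_succ n hN
  omega

lemma le_card (P : ℕ → Prop) [DecidablePred P] (N : ℕ)
    (hP : Function.Periodic P N) (n : ℕ) :
    (n / N) * Nat.count P N ≤ ((Finset.range n).filter P).card := by
  rw [← card_mul P N hP 0, Finset.range_eq_Ico]
  apply Finset.card_le_card
  apply Finset.filter_subset_filter
  apply Finset.Ico_subset_Ico le_rfl
  have := Nat.mul_div_le n N
  omega

def NK (b : ℕ → ℕ) (K : ℕ) : ℕ := ∏ i ∈ Finset.range K, b i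

def PK (b : ℕ → ℕ) (K : ℕ) (m : ℕ) : Prop := ∀ i ∈ Finset.range K, ¬ b i ∣ m

instance (b : ℕ → ℕ) (K : ℕ) : DecidablePred (PK b K) := fun m => by unfold PK; infer_instance

lemma PK_per (b : ℕ → ℕ) (K : ℕ) : Function.Periodic (PK b K) (NK b K) := by
  intro m
  unfold PK
  apply propext
  apply forall₂_congr
  intro i hi
  have : b i ∣ NK b K := Finset.dvd_prod_of_mem _ hi
  rw [(Nat.dvd_add_iff_left this).symm]

lemma NK_pos (b : ℕ → ℕ) (hb : ∀ i, 2 ≤ b i) (K : ℕ) : 0 < NK b K :=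
  Finset.prod_pos fun i _ => by have := hb i; omega

lemma crt (b : ℕ → ℕ) (hb : ∀ i, 2 ≤ b i)
    (hcop : ∀ i j, i ≠ j → Nat.Coprime (b i) (b j)) (K : ℕ) (r : ∀ i, ZMod (b i)) :
    ∃ s ∈ Finset.range (NK b K), ∀ i ∈ Finset.range K, (s : ZMod (b i)) = r i := by
  have hne : ∀ i, NeZero (b i) := fun i => ⟨by have := hb i; omega⟩
  let x := Nat.chineseRemainderOfFinset (fun i => (r i).val) b (Finset.range K)
    (fun i _ => by have := hb i; omega) (fun i _ j _ h => hcop i j h)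
  refine ⟨x.1 % NK b K, Finset.mem_range.2 (Nat.mod_lt _ (NK_pos b hb K)), fun i hi => ?_⟩
  have h1 := x.2 i hi
  have h2 : (x.1 % NK b K) ≡ (r i).val [MOD b i] :=
    ((Nat.mod_modEq _ _).of_dvd (Finset.dvd_prod_of_mem _ hi)).trans h1
  have h3 := (ZMod.natCast_eq_natCast_iff _ _ _).2 h2
  rw [h3, ZMod.natCast_zmod_val]

/-- number of ones of η in `[0,n)` -/
def DD (η : FullShift) (n : ℕ) : ℕ := ((Finset.range n).filter fun m : ℕ => η (m : ℤ) = 1).card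

lemma dens_low (b : ℕ → ℕ)
    (hsum : Summable fun i => (1 : ℝ) / b i)
    (η : FullShift) (hη : ∀ m : ℤ, η m = 1 ↔ ∀ i, ¬ ((b i : ℤ) ∣ m)) (K n : ℕ) :
    ((n / NK b K : ℕ) : ℝ) * Nat.count (PK b K) (NK b K) ≤
      DD η n + 1 + n * ∑' i, (1 : ℝ) / b (i + K) := by
  classical
  let S := (Finset.range n).filter fun m : ℕ => m ≠ 0 ∧ ∃ i, b (i + K) ∣ m
  have hS : (S.card : ℝ) ≤ n * ∑' i, (1 : ℝ) / b (i + K) := by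
    let f : ℕ → ℕ := fun m => if h : ∃ i, b (i + K) ∣ m then h.choose else 0
    have hf : ∀ m ∈ S, b (f m + K) ∣ m := by
      intro m hm
      have h := (Finset.mem_filter.1 hm).2.2
      simp only [f, dif_pos h]
      exact h.choose_spec
    have h1 : S.card = ∑ i ∈ S.image f, (S.filter fun m => f m = i).card :=
      Finset.card_eq_sum_card_image f S
    have h2 : ∀ i, ((S.filter fun m => f m = i).card : ℝ) ≤ n * ((1 : ℝ) / b (i + K)) := by
      intro i
      have h3 : (S.filter fun m => f m = i).card ≤ n / b (i + K) := by
        rw [← Nat.Ioc_filter_dvd_card_eq_div]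
        apply Finset.card_le_card
        intro m hm
        rw [Finset.mem_filter] at hm
        have h4 := hf m hm.1
        rw [hm.2] at h4
        have h5 := Finset.mem_filter.1 hm.1
        rw [Finset.mem_filter, Finset.mem_Ioc]
        have := Finset.mem_range.1 h5.1
        exact ⟨⟨Nat.pos_of_ne_zero h5.2.1, this.le⟩, h4⟩
      calc ((S.filter fun m => f m = i).card : ℝ) ≤ ((n / b (i + K) : ℕ) : ℝ) := by exact_mod_cast h3
        _ ≤ (n : ℝ) / b (i + K) := Nat.cast_div_le
        _ = _ := by ring
    rw [h1]
    push_cast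
    calc _ ≤ ∑ i ∈ S.image f, n * ((1 : ℝ) / b (i + K)) := Finset.sum_le_sum fun i _ => h2 i
      _ = n * ∑ i ∈ S.image f, ((1 : ℝ) / b (i + K)) := by rw [Finset.mul_sum]
      _ ≤ _ := by
        gcongr
        have := (summable_nat_add_iff (f := fun i => (1 : ℝ) / b i) K).2 hsum
        exact this.sum_le_tsum _ (fun i _ => by positivity)
  have hc : ((Finset.range n).filter (PK b K)).card ≤ DD η n + 1 + S.card := by
    have : (Finset.range n).filter (PK b K) ⊆
        (((Finset.range n).filter fun m : ℕ => η (m : ℤ) = 1) ∪ {0}) ∪ S := by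
      intro m hm
      rw [Finset.mem_filter] at hm
      simp only [Finset.mem_union, Finset.mem_filter, Finset.mem_singleton, S]
      by_cases h0 : m = 0
      · exact Or.inl (Or.inr h0)
      by_cases h1 : η (m : ℤ) = 1
      · exact Or.inl (Or.inl ⟨hm.1, h1⟩)
      right
      refine ⟨hm.1, h0, ?_⟩
      rw [hη] at h1
      push Not at h1
      obtain ⟨i, hi⟩ := h1
      have hi' : b i ∣ m := by exact_mod_cast hi
      have hK : ¬ i < K := fun h => hm.2 i (Finset.mem_range.2 h) hi'
      refine ⟨i - K, ?_⟩
      rwa [Nat.sub_add_cancel (by omega)]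
    refine (Finset.card_le_card this).trans ((Finset.card_union_le _ _).trans ?_)
    gcongr
    exact (Finset.card_union_le _ _)
  have h := (le_card (PK b K) (NK b K) (PK_per b K) n).trans hc
  have h' : ((n / NK b K : ℕ) : ℝ) * Nat.count (PK b K) (NK b K) ≤ DD η n + 1 + S.card := by
    exact_mod_cast h
  linarith

lemma dens_lim (b : ℕ → ℕ) (hb : ∀ i, 2 ≤ b i)
    (hsum : Summable fun i => (1 : ℝ) / b i)
    (η : FullShift) (hη : ∀ m : ℤ, η m = 1 ↔ ∀ i, ¬ ((b i : ℤ) ∣ m)) (d : ℝ)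
    (hd : Tendsto (fun n : ℕ => (DD η n : ℝ) / n) atTop (nhds d)) (K : ℕ) :
    (Nat.count (PK b K) (NK b K) : ℝ) / NK b K ≤ d + ∑' i, (1 : ℝ) / b (i + K) := by
  have hN := NK_pos b hb K
  set N := NK b K
  set c := Nat.count (PK b K) N
  have h1 : Tendsto (fun n : ℕ => (DD η n : ℝ) / n + ((1 + c : ℝ) / n) + ∑' i, (1 : ℝ) / b (i + K))
      atTop (nhds (d + 0 + ∑' i, (1 : ℝ) / b (i + K))) :=
    (hd.add (tendsto_const_div_atTop_nhds_zero_nat _)).add tendsto_const_nhds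
  rw [add_zero] at h1
  refine ge_of_tendsto h1 ?_
  filter_upwards [eventually_gt_atTop 0] with n hn
  have h2 := dens_low b hsum η hη K n
  have h3 : (n : ℝ) / N ≤ ((n / N : ℕ) : ℝ) + 1 := by
    rw [div_le_iff₀ (by exact_mod_cast hN)]
    have := (Nat.lt_mul_div_succ n hN).le
    have h : (n : ℝ) ≤ N * ((n / N : ℕ) + 1) := by exact_mod_cast this
    linarith
  have h4 : (n : ℝ) / N * c ≤ (((n / N : ℕ) : ℝ) + 1) * c := by gcongr
  have hn' : (0 : ℝ) < n := by exact_mod_cast hn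
  have h5 : (n : ℝ) * (c / N) ≤ DD η n + (1 + c) + n * ∑' i, (1 : ℝ) / b (i + K) := by
    have : (n : ℝ) * (c / N) = (n : ℝ) / N * c := by ring
    rw [this]
    change ((n / N : ℕ) : ℝ) * c ≤ _ at h2
    linarith
  rw [← mul_le_mul_iff_right₀ hn']
  refine h5.trans (le_of_eq ?_)
  field_simp

/-! words -/

lemma pow_ones {n : ℕ} (t : ℝ) (W : Fin n → Fin 2) :
    t ^ ones W = ∏ i, (if W i = 1 then t else 1) := by
  unfold ones
  rw [Finset.prod_ite]
  simp

lemma sum_pi {n : ℕ} (S : Fin n → Finset (Fin 2)) (t : ℝ) :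
    ∑ W ∈ Fintype.piFinset S, t ^ ones W = ∏ i, ∑ u ∈ S i, (if u = 1 then t else 1) := by
  rw [Finset.prod_univ_sum]
  exact Finset.sum_congr rfl fun W _ => pow_ones t W

open Classical in
noncomputable def LL (b : ℕ → ℕ) (n : ℕ) : Finset (Fin n → Fin 2) :=
  Finset.univ.filter (fun W : Fin n → Fin 2 => (XB b ∩ cylinder W).Nonempty)

lemma fin2 (u : Fin 2) (h : u ≠ 1) : u = 0 := by omega

lemma sum_biUnion_le' {ι α : Type*} [DecidableEq ι] [DecidableEq α] (s : Finset ι)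
    (S : ι → Finset α) (f : α → ℝ)
    (hf : ∀ a, 0 ≤ f a) : ∑ a ∈ s.biUnion S, f a ≤ ∑ i ∈ s, ∑ a ∈ S i, f a := by
  induction s using Finset.induction_on with
  | empty => simp
  | insert i s hi ih =>
    rw [Finset.biUnion_insert, Finset.sum_insert hi]
    have := Finset.sum_union_inter (s₁ := S i) (s₂ := s.biUnion S) (f := f)
    have h2 : 0 ≤ ∑ a ∈ S i ∩ s.biUnion S, f a := Finset.sum_nonneg fun a _ => hf a
    linarith

lemma Z_le (b : ℕ → ℕ) (hb : ∀ i, 2 ≤ b i)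
    (hcop : ∀ i j, i ≠ j → Nat.Coprime (b i) (b j)) (t : ℝ) (ht : 0 < t) (K n : ℕ) :
    ∑ W ∈ LL b n, t ^ ones W ≤
      NK b K * (1 + t) ^ ((n / NK b K + 1) * Nat.count (PK b K) (NK b K)) := by
  classical
  let S : ℕ → Fin n → Finset (Fin 2) := fun s i => if PK b K (s + i) then Finset.univ else {0}
  have hsub : LL b n ⊆ (Finset.range (NK b K)).biUnion fun s => Fintype.piFinset (S s) := by
    intro W hW
    obtain ⟨x, hx, hxW⟩ := (Finset.mem_filter.1 hW).2
    choose r hr using hx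
    obtain ⟨s, hs, hs'⟩ := crt b hb hcop K (fun i => - r i)
    refine Finset.mem_biUnion.2 ⟨s, hs, Fintype.mem_piFinset.2 fun i => ?_⟩
    simp only [S]
    split_ifs with h
    · simp
    · rw [Finset.mem_singleton]
      apply fin2
      intro h1
      apply h
      intro j hj hdv
      have h2 := hr j ((i : ℕ) : ℤ) (by rw [hxW i, h1])
      apply h2
      have h3 : ((s + i : ℕ) : ZMod (b j)) = 0 := (ZMod.natCast_eq_zero_iff _ _).2 hdv
      push_cast at h3 ⊢
      rw [hs' j hj] at h3
      linear_combination h3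
  have hpos : ∀ W : Fin n → Fin 2, 0 ≤ t ^ ones W := fun W => by positivity
  calc _ ≤ ∑ W ∈ (Finset.range (NK b K)).biUnion fun s => Fintype.piFinset (S s), t ^ ones W :=
        Finset.sum_le_sum_of_subset_of_nonneg hsub fun W _ _ => hpos W
    _ ≤ ∑ s ∈ Finset.range (NK b K), ∑ W ∈ Fintype.piFinset (S s), t ^ ones W :=
        sum_biUnion_le' _ _ _ hpos
    _ ≤ ∑ s ∈ Finset.range (NK b K),
          (1 + t) ^ ((n / NK b K + 1) * Nat.count (PK b K) (NK b K)) := by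
        apply Finset.sum_le_sum
        intro s _
        rw [sum_pi]
        have h1 : ∀ i : Fin n, ∑ u ∈ S s i, (if u = 1 then t else 1) =
            if PK b K (s + i) then (1 + t) else 1 := by
          intro i
          simp only [S]
          split_ifs <;> simp
        simp_rw [h1]
        rw [Finset.prod_ite, Finset.prod_const, Finset.prod_const_one, mul_one]
        apply pow_le_pow_right₀ (by linarith)
        refine le_trans ?_ (card_le (PK b K) (NK b K) (NK_pos b hb K) (PK_per b K) s n)
        apply Finset.card_le_card_of_injOn (fun i : Fin n => s + i)
        · intro i hi
          have := (Finset.mem_filter.1 hi).2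
          simp only [Finset.coe_filter, Set.mem_ofPred_eq, Finset.mem_Ico]
          exact ⟨⟨by omega, by omega⟩, this⟩
        · intro i _ j _ h
          simp only at h
          ext
          omega
    _ = _ := by simp

lemma Z_lim (b : ℕ → ℕ) (hb : ∀ i, 2 ≤ b i)
    (hcop : ∀ i j, i ≠ j → Nat.Coprime (b i) (b j))
    (hsum : Summable fun i => (1 : ℝ) / b i)
    (η : FullShift) (hη : ∀ m : ℤ, η m = 1 ↔ ∀ i, ¬ ((b i : ℤ) ∣ m)) (d : ℝ)
    (hd : Tendsto (fun n : ℕ => (DD η n : ℝ) / n) atTop (nhds d))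
    (t : ℝ) (ht : 0 < t)
    (hlow : ∀ n : ℕ, n * d * Real.log (1 + t) ≤ Real.log (∑ W ∈ LL b n, t ^ ones W))
    (hpos : ∀ n : ℕ, 0 < ∑ W ∈ LL b n, t ^ ones W) :
    Tendsto (fun n : ℕ => Real.log (∑ W ∈ LL b n, t ^ ones W) / n) atTop
      (nhds (d * Real.log (1 + t))) := by
  have hL : 0 < Real.log (1 + t) := Real.log_pos (by linarith)
  set L := Real.log (1 + t)
  rw [tendsto_order]
  constructor
  · intro a ha
    filter_upwards [eventually_gt_atTop 0] with n hn
    have hn' : (0 : ℝ) < n := by exact_mod_cast hn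
    refine ha.trans_le ?_
    rw [le_div_iff₀ hn']
    have := hlow n
    linarith
  · intro a ha
    have htail : Tendsto (fun K => (d + ∑' i, (1 : ℝ) / b (i + K)) * L) atTop (nhds ((d + 0) * L)) :=
      (tendsto_const_nhds.add (tendsto_sum_nat_add (fun i => (1 : ℝ) / b i))).mul_const L
    rw [add_zero] at htail
    obtain ⟨K, hK⟩ := (htail.eventually_lt_const ha).exists
    have hN := NK_pos b hb K
    have hden := dens_lim b hb hsum η hη d hd K
    have hZ := Z_le b hb hcop t ht K
    set N := NK b K
    set c := Nat.count (PK b K) N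
    have h1 : Tendsto (fun n : ℕ => (c : ℝ) / N * L + (Real.log N + c * L) / n) atTop
        (nhds ((c : ℝ) / N * L + 0)) :=
      tendsto_const_nhds.add (tendsto_const_div_atTop_nhds_zero_nat _)
    rw [add_zero] at h1
    have h2 : (c : ℝ) / N * L < a := lt_of_le_of_lt (by gcongr) hK
    filter_upwards [h1.eventually_lt_const h2, eventually_gt_atTop 0] with n hna hn
    have hn' : (0 : ℝ) < n := by exact_mod_cast hn
    have hN' : (0 : ℝ) < N := by exact_mod_cast hN
    refine lt_of_le_of_lt ?_ hna
    have h3 := Real.log_le_log (hpos n) (hZ n)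
    rw [Real.log_mul (by positivity) (by positivity), Real.log_pow] at h3
    rw [div_le_iff₀ hn']
    refine h3.trans ?_
    have h4 : ((n / N : ℕ) : ℝ) ≤ (n : ℝ) / N := Nat.cast_div_le
    push_cast
    calc Real.log N + (((n / N : ℕ) : ℝ) + 1) * c * L ≤ Real.log N + ((n : ℝ) / N + 1) * c * L := by
          gcongr
      _ = _ := by field_simp; ring

lemma meas_cyl {n : ℕ} (W : Fin n → Fin 2) : MeasurableSet (cylinder W) := by
  have : cylinder W = ⋂ i : Fin n, (fun x : FullShift => x ((i : ℕ) : ℤ)) ⁻¹' {W i} := by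
    ext x; simp [_root_.cylinder]
  rw [this]
  exact MeasurableSet.iInter fun i => (measurable_pi_apply _) (MeasurableSet.singleton _)

lemma meas_one (i : ℤ) : MeasurableSet {x : FullShift | x i = 1} :=
  measurableSet_eq_fun (f := fun x : FullShift => x i) (g := fun _ => 1)
    (measurable_pi_apply i) measurable_const

lemma meas_Q : Measurable Qmul := by
  apply measurable_pi_lambda
  intro i
  have h : Measurable (fun p : Fin 2 × Fin 2 => p.1 * p.2) := measurable_of_finite _
  have h1 : Measurable (fun x : FullShift × FullShift => x.1 i) :=
    (measurable_pi_apply i).comp measurable_fst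
  have h2 : Measurable (fun x : FullShift × FullShift => x.2 i) :=
    (measurable_pi_apply i).comp measurable_snd
  exact h.comp (h1.prodMk h2)

lemma mem_cyl {n : ℕ} (W : Fin n → Fin 2) (x : FullShift) : x ∈ cylinder W ↔ wordAt x n = W := by
  unfold _root_.cylinder wordAt
  rw [funext_iff]
  rfl

lemma shift_it (x : FullShift) (j : ℕ) : ∀ m : ℤ, (shift^[j] x) m = x (m + j) := by
  induction j generalizing x with
  | zero => intro m; simp
  | succ j ih =>
    intro m
    rw [Function.iterate_succ_apply, ih]
    simp only [shift]
    congr 1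
    push_cast
    ring

lemma meas_set (ρ : Measure FullShift) [IsProbabilityMeasure ρ] {n : ℕ}
    (F : Finset (Fin n → Fin 2)) :
    (ρ {x | wordAt x n ∈ F}).toReal = ∑ V ∈ F, (ρ (cylinder V)).toReal := by
  have h : {x | wordAt x n ∈ F} = ⋃ V ∈ F, cylinder V := by
    ext x; simp [mem_cyl]
  rw [h, measure_biUnion_finset, ENNReal.toReal_sum]
  · intro V _; exact measure_ne_top _ _
  · intro V _ U _ hVU
    apply Set.disjoint_left.2
    intro x h1 h2
    rw [mem_cyl] at h1 h2
    exact hVU (h1.symm.trans h2)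
  · intro V _; exact meas_cyl V

lemma sum_cyl (ρ : Measure FullShift) [IsProbabilityMeasure ρ] (n : ℕ) :
    ∑ V : Fin n → Fin 2, (ρ (cylinder V)).toReal = 1 := by
  rw [← meas_set]
  simp

lemma exp_ones (ρ : Measure FullShift) [IsProbabilityMeasure ρ] (n : ℕ) (d : ℝ)
    (hd : ∀ i : ℕ, (ρ {x | x (i : ℤ) = 1}).toReal = d) :
    ∑ V : Fin n → Fin 2, (ρ (cylinder V)).toReal * ones V = n * d := by
  have h1 : ∀ V : Fin n → Fin 2, (ρ (cylinder V)).toReal * ones V =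
      ∑ i : Fin n, if V i = 1 then (ρ (cylinder V)).toReal else 0 := by
    intro V
    rw [← Finset.sum_filter, Finset.sum_const, nsmul_eq_mul, mul_comm]
    rfl
  simp_rw [h1]
  rw [Finset.sum_comm]
  have h2 : ∀ i : Fin n, (∑ V : Fin n → Fin 2, if V i = 1 then (ρ (cylinder V)).toReal else 0) = d := by
    intro i
    rw [← Finset.sum_filter, ← meas_set, ← hd i]
    congr 2
    ext x
    simp [wordAt]
  simp [h2]

lemma mu_cyl (ν B : Measure FullShift) [IsProbabilityMeasure ν] [IsProbabilityMeasure B]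
    {n : ℕ} (W : Fin n → Fin 2) :
    (((ν.prod B).map Qmul) (cylinder W)).toReal =
      ∑ V : Fin n → Fin 2, (ν (cylinder V)).toReal *
        ∑ U ∈ Finset.univ.filter (fun U : Fin n → Fin 2 => V * U = W), (B (cylinder U)).toReal := by
  rw [Measure.map_apply meas_Q (meas_cyl W)]
  have h : Qmul ⁻¹' cylinder W = ⋃ V ∈ (Finset.univ : Finset (Fin n → Fin 2)),
      cylinder V ×ˢ {y | wordAt y n ∈ Finset.univ.filter (fun U : Fin n → Fin 2 => V * U = W)} := by
    ext ⟨x, y⟩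
    simp only [Set.mem_preimage, mem_cyl, Set.mem_iUnion, Set.mem_prod, Finset.mem_filter,
      Finset.mem_univ, true_and, Set.mem_ofPred_eq, exists_prop, exists_eq_left']
    rfl
  rw [h, measure_biUnion_finset, ENNReal.toReal_sum]
  · apply Finset.sum_congr rfl
    intro V _
    rw [Measure.prod_prod, ENNReal.toReal_mul, meas_set]
  · intro V _; exact measure_ne_top _ _
  · intro V _ U _ hVU
    apply Set.disjoint_left.2
    rintro ⟨x, y⟩ h1 h2
    have h1 := (mem_cyl _ _).1 h1.1
    have h2 := (mem_cyl _ _).1 h2.1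
    exact hVU (h1.symm.trans h2)
  · intro V _
    apply (meas_cyl V).prod
    have : {y | wordAt y n ∈ Finset.univ.filter (fun U : Fin n → Fin 2 => V * U = W)} =
        ⋃ U ∈ Finset.univ.filter (fun U : Fin n → Fin 2 => V * U = W), cylinder U := by
      ext x; simp [mem_cyl]
    rw [this]
    exact Finset.measurableSet_biUnion _ fun U _ => meas_cyl U

lemma zeros_add_ones {n : ℕ} (W : Fin n → Fin 2) : zeros W + ones W = n := by
  unfold zeros ones
  have := Finset.card_filter_add_card_filter_not (s := (Finset.univ : Finset (Fin n)))
    (fun i => W i = 0)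
  rw [Finset.card_univ, Fintype.card_fin] at this
  convert this using 3
  ext i
  simp only [Finset.mem_filter, Finset.mem_univ, true_and]
  omega

lemma B_eq {n : ℕ} (t p : ℝ) (hp1 : 1 - p = t * p) (W : Fin n → Fin 2) :
    p ^ zeros W * (1 - p) ^ ones W = p ^ n * t ^ ones W := by
  have h : p ^ n = p ^ zeros W * p ^ ones W := by rw [← pow_add, zeros_add_ones W]
  rw [hp1, mul_pow, h]
  ring

lemma B_one (B : Measure FullShift) [IsProbabilityMeasure B] (t p : ℝ) (hp1 : 1 - p = t * p)
    (hB : ∀ (n : ℕ) (W : Fin n → Fin 2),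
      (B (cylinder W)).toReal = p ^ zeros W * (1 - p) ^ ones W) (i : ℕ) :
    (B {x | x (i : ℤ) = 1}).toReal = 1 - p := by
  let S : Fin (i + 1) → Finset (Fin 2) := fun j => if j = Fin.last i then {1} else Finset.univ
  have h1 : {x : FullShift | x (i : ℤ) = 1} = {x | wordAt x (i + 1) ∈ Fintype.piFinset S} := by
    ext x
    simp only [Set.mem_ofPred_eq, Fintype.mem_piFinset, S]
    constructor
    · intro h j
      split_ifs with hj
      · subst hj
        simpa [wordAt] using h
      · simp
    · intro h
      simpa [wordAt] using h (Fin.last i)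
  rw [h1, meas_set]
  simp_rw [hB, B_eq t p hp1]
  rw [← Finset.mul_sum, sum_pi, Fin.prod_univ_castSucc]
  have h2 : ∀ j : Fin i, ∑ u ∈ S j.castSucc, (if u = 1 then t else 1) = 1 + t := by
    intro j
    simp [S, (Fin.castSucc_lt_last j).ne]
  simp_rw [h2]
  have h3 : p * (1 + t) = 1 := by linarith
  simp only [S, Finset.prod_const, Finset.card_univ, Fintype.card_fin, if_true,
    Finset.sum_singleton]
  rw [hp1, pow_succ]
  calc _ = (p * (1 + t)) ^ i * (t * p) := by rw [mul_pow]; ring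
    _ = _ := by rw [h3]; simp

/-- conditional law of the product word -/
noncomputable def kv (t p : ℝ) {n : ℕ} (V W : Fin n → Fin 2) : ℝ :=
  ∑ U ∈ Finset.univ.filter (fun U : Fin n → Fin 2 => V * U = W), p ^ n * t ^ ones U

lemma kv_sum (t p : ℝ) (hp1 : 1 - p = t * p) {n : ℕ} (V : Fin n → Fin 2) :
    ∑ W, kv t p V W = 1 := by
  unfold kv
  rw [Finset.sum_fiberwise, ← Finset.mul_sum]
  have := sum_pi (n := n) (fun _ => Finset.univ) t
  rw [Fintype.piFinset_univ] at this
  rw [this]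
  have h3 : p * (1 + t) = 1 := by linarith
  simp [← mul_pow, h3]

lemma kv_eq (t p : ℝ) (hp1 : 1 - p = t * p) {n : ℕ} (V W : Fin n → Fin 2) :
    kv t p V W = if ∀ i, W i = 1 → V i = 1 then t ^ ones W * p ^ ones V else 0 := by
  have hS : Finset.univ.filter (fun U : Fin n → Fin 2 => V * U = W) =
      Fintype.piFinset fun i => Finset.univ.filter fun u => V i * u = W i := by
    ext U
    simp [funext_iff]
  have hc : p ^ n = ∏ _i : Fin n, p := by simp
  unfold kv
  rw [← Finset.mul_sum, hS, sum_pi, hc, ← Finset.prod_mul_distrib]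
  have h : ∀ v w : Fin 2, p * ∑ u ∈ Finset.univ.filter (fun u => v * u = w), (if u = 1 then t else 1)
      = if w = 1 → v = 1 then (if w = 1 then t else 1) * (if v = 1 then p else 1) else 0 := by
    intro v w
    fin_cases v <;> fin_cases w <;> simp [Finset.sum_filter] <;> linarith
  simp_rw [h]
  split_ifs with hle
  · rw [pow_ones, pow_ones, ← Finset.prod_mul_distrib]
    exact Finset.prod_congr rfl fun i _ => by rw [if_pos (hle i)]
  · push Not at hle
    obtain ⟨i, h1, h2⟩ := hle
    apply Finset.prod_eq_zero (Finset.mem_univ i)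
    rw [if_neg]
    tauto

lemma kv_nonneg (t p : ℝ) (ht : 0 < t) (hp0 : 0 < p) {n : ℕ} (V W : Fin n → Fin 2) :
    0 ≤ kv t p V W := by
  unfold kv
  positivity

lemma kv_log (t p : ℝ) (ht : 0 < t) (hp1 : 1 - p = t * p) {n : ℕ} (V W : Fin n → Fin 2) :
    Real.negMulLog (kv t p V W) =
      kv t p V W * (ones V * Real.log (1 + t) - ones W * Real.log t) := by
  have h3 : p * (1 + t) = 1 := by linarith
  have hp : p = (1 + t)⁻¹ := eq_inv_of_mul_eq_one_left h3
  rw [kv_eq t p hp1]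
  split_ifs
  · unfold Real.negMulLog
    have : 0 < p := by rw [hp]; positivity
    rw [Real.log_mul (by positivity) (by positivity), Real.log_pow, Real.log_pow]
    conv_lhs => rw [show Real.log p = - Real.log (1 + t) by rw [hp, Real.log_inv]]
    ring
  · simp

lemma gibbs {ι : Type*} (s : Finset ι) (m w : ι → ℝ) (hm : ∀ i, 0 ≤ m i) (h1 : ∑ i ∈ s, m i = 1)
    (hw : ∀ i, 0 < w i) :
    ∑ i ∈ s, (Real.negMulLog (m i) + m i * Real.log (w i)) ≤ Real.log (∑ i ∈ s, w i) := by
  have hne : s.Nonempty := by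
    rw [Finset.nonempty_iff_ne_empty]; rintro rfl; simp at h1
  have hZ : 0 < ∑ i ∈ s, w i := Finset.sum_pos (fun i _ => hw i) hne
  set Z := ∑ i ∈ s, w i with hZdef
  have h : ∀ i ∈ s, Real.negMulLog (m i) + m i * Real.log (w i) ≤ m i * Real.log Z + (w i / Z - m i) := by
    intro i _
    rcases (hm i).eq_or_lt with h0 | h0
    · rw [← h0]
      simp
      have := hw i
      positivity
    · have hwi := hw i
      have := Real.log_le_sub_one_of_pos (show 0 < w i / (m i * Z) by positivity)
      rw [Real.log_div (by positivity) (by positivity), Real.log_mul (by positivity) (by positivity)] at this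
      have h2 := mul_le_mul_of_nonneg_left this h0.le
      have h3 : m i * (w i / (m i * Z) - 1) = w i / Z - m i := by field_simp
      rw [h3] at h2
      unfold Real.negMulLog
      linarith
  refine (Finset.sum_le_sum h).trans (le_of_eq ?_)
  rw [Finset.sum_add_distrib, Finset.sum_sub_distrib, ← Finset.sum_mul, ← Finset.sum_div, h1,
    ← hZdef, div_self hZ.ne']
  ring

lemma ent_low (t p : ℝ) (ht : 0 < t) (hp0 : 0 < p) (hp1 : 1 - p = t * p) {n : ℕ}
    (v m : (Fin n → Fin 2) → ℝ) (hv : ∀ V, 0 ≤ v V) (hv1 : ∑ V, v V = 1)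
    (hm : ∀ W, m W = ∑ V, v V * kv t p V W) :
    (∑ V, v V * ones V) * Real.log (1 + t) - (∑ W, m W * ones W) * Real.log t ≤
      ∑ W, Real.negMulLog (m W) := by
  have h1 : ∀ W, ∑ V, v V * Real.negMulLog (kv t p V W) ≤ Real.negMulLog (m W) := by
    intro W
    rw [hm]
    have := Real.concaveOn_negMulLog.le_map_sum (t := Finset.univ) (w := v)
      (p := fun V => kv t p V W) (fun V _ => hv V) hv1
      (fun V _ => kv_nonneg t p ht hp0 V W)
    simpa using this
  refine le_trans (le_of_eq ?_) (Finset.sum_le_sum fun W _ => h1 W)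
  simp_rw [kv_log t p ht hp1]
  have h2 : ∀ W V : Fin n → Fin 2, v V * (kv t p V W * (ones V * Real.log (1 + t) - ones W * Real.log t))
      = (v V * ones V * Real.log (1 + t)) * kv t p V W -
        (v V * kv t p V W) * ones W * Real.log t := by
    intro W V; ring
  simp_rw [h2, Finset.sum_sub_distrib]
  congr 1
  · rw [Finset.sum_comm]
    simp_rw [← Finset.mul_sum, kv_sum t p hp1, mul_one, Finset.sum_mul]
  · simp_rw [← Finset.sum_mul, ← hm]

/-! frequencies -/

lemma freq_eq (η : FullShift) {k : ℕ} (W : Fin k → Fin 2) (n : ℕ) :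
    freqCount η W n = ∑ j ∈ Finset.range n, if wordAt (shift^[j] η) k = W then 1 else 0 := by
  unfold freqCount
  rw [Finset.card_filter]
  simp_rw [mem_cyl]

lemma freq_shift (η : FullShift) (d : ℝ)
    (hd : Tendsto (fun n : ℕ => (DD η n : ℝ) / n) atTop (nhds d)) (i : ℕ) :
    Tendsto (fun n : ℕ => ((∑ j ∈ Finset.range n, if η ((i : ℤ) + j) = 1 then 1 else 0 : ℕ) : ℝ) / n)
      atTop (nhds d) := by
  have h1 : ∀ n, (∑ j ∈ Finset.range n, if η ((i : ℤ) + j) = 1 then 1 else 0) + DD η i = DD η (n + i) := by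
    intro n
    unfold DD
    rw [Finset.card_filter, Finset.card_filter, add_comm n i, Finset.sum_range_add, add_comm]
    push_cast
    try rfl
  have h2 := hd.comp (tendsto_add_atTop_nat i)
  have h3 : Tendsto (fun n : ℕ => (1 : ℝ) + (i : ℝ) / n) atTop (nhds (1 + 0)) :=
    tendsto_const_nhds.add (tendsto_const_div_atTop_nhds_zero_nat _)
  have h4 := (h2.mul h3).sub (tendsto_const_div_atTop_nhds_zero_nat (DD η i : ℝ))
  simp only [add_zero, mul_one, sub_zero] at h4
  refine h4.congr' ?_
  filter_upwards [eventually_gt_atTop 0] with n hn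
  have hn' : (0 : ℝ) < n := by exact_mod_cast hn
  simp only [Function.comp]
  rw [← h1 n]
  push_cast
  field_simp
  try ring

lemma nu_one (η : FullShift) (ν : Measure FullShift) [IsProbabilityMeasure ν]
    (hgen : ∀ (k : ℕ) (W : Fin k → Fin 2),
      Tendsto (fun n : ℕ => (freqCount η W n : ℝ) / n) atTop
        (nhds ((ν (cylinder W)).toReal))) (d : ℝ)
    (hd : Tendsto (fun n : ℕ => (DD η n : ℝ) / n) atTop (nhds d)) (i : ℕ) :
    (ν {x | x (i : ℤ) = 1}).toReal = d := by
  have h0 : {x : FullShift | x (i : ℤ) = 1} = {x | wordAt x (i + 1) ∈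
      (Finset.univ.filter fun V : Fin (i + 1) → Fin 2 => V (Fin.last i) = 1)} := by
    ext x; simp [wordAt]
  rw [h0, meas_set]
  refine tendsto_nhds_unique (tendsto_finsetSum _ fun V _ => hgen (i + 1) V) ?_
  refine (freq_shift η d hd i).congr fun n => ?_
  rw [← Finset.sum_div]
  congr 1
  simp_rw [freq_eq]
  push_cast
  rw [Finset.sum_comm]
  apply Finset.sum_congr rfl
  intro j _
  rw [Finset.sum_ite_eq]
  simp [wordAt, shift_it]

lemma DD_lim (η : FullShift) (ν : Measure FullShift) [IsProbabilityMeasure ν]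
    (hgen : ∀ (k : ℕ) (W : Fin k → Fin 2),
      Tendsto (fun n : ℕ => (freqCount η W n : ℝ) / n) atTop
        (nhds ((ν (cylinder W)).toReal))) :
    ∃ d, Tendsto (fun n : ℕ => (DD η n : ℝ) / n) atTop (nhds d) := by
  refine ⟨_, (hgen 1 (fun _ => 1)).congr fun n => ?_⟩
  congr 2
  rw [freq_eq, DD, Finset.card_filter]
  apply Finset.sum_congr rfl
  intro j _
  simp [wordAt, shift_it, funext_iff]

lemma mu_one (ν B : Measure FullShift) [IsProbabilityMeasure ν] [IsProbabilityMeasure B] (i : ℤ) :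
    (((ν.prod B).map Qmul) {x | x i = 1}).toReal =
      (ν {x | x i = 1}).toReal * (B {x | x i = 1}).toReal := by
  rw [Measure.map_apply meas_Q (meas_one i), ← ENNReal.toReal_mul, ← Measure.prod_prod]
  congr 2
  ext ⟨x, y⟩
  simp only [Set.mem_preimage, Set.mem_ofPred_eq, Qmul, Set.mem_prod]
  generalize x i = u
  generalize y i = v
  revert u v
  decide

lemma XB_consec (b : ℕ → ℕ) (h2 : b 0 = 2) (x : FullShift) (hx : x ∈ XB b) (m : ℤ) :
    ¬ (x m = 1 ∧ x (m + 1) = 1) := by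
  rintro ⟨h, h'⟩
  obtain ⟨r, hr⟩ := hx 0
  have e1 := hr m h
  have e2 := hr (m + 1) h'
  revert r
  rw [h2]
  intro r hr e1 e2
  push_cast at e2
  generalize (m : ZMod 2) = z at *
  clear hr
  revert r z
  decide

lemma eta_mem (b : ℕ → ℕ) (η : FullShift) (hη : ∀ m : ℤ, η m = 1 ↔ ∀ i, ¬ ((b i : ℤ) ∣ m)) 
    (j : ℕ) (x : FullShift) (hx : ∀ m, x m = 1 → η (m + j) = 1) : x ∈ XB b := by
  intro i
  refine ⟨-(j : ZMod (b i)), fun m hm h => ?_⟩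
  apply (hη _).1 (hx m hm) i
  rw [← ZMod.intCast_zmod_eq_zero_iff_dvd]
  push_cast
  rw [h]
  ring

lemma phi_eq (a00 a01 a1 : ℝ) (x : FullShift) (hx : ¬ (x 0 = 1 ∧ x 1 = 1)) :
    phi012 a00 a01 a1 x = a00 + (a1 - a00) * (if x 0 = 1 then 1 else 0) +
      (a01 - a00) * (if x 1 = 1 then 1 else 0) := by
  unfold phi012
  generalize x 0 = u at *
  generalize x 1 = v at *
  fin_cases u <;> fin_cases v <;> simp at hx ⊢

lemma birk_eq (a00 a01 a1 : ℝ) (x : FullShift) (hx : ∀ m, ¬ (x m = 1 ∧ x (m + 1) = 1)) (n : ℕ) :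
    birkhoff (phi012 a00 a01 a1) n x = n * a00 + (a1 + a01 - 2 * a00) * ones (wordAt x n) +
      (a01 - a00) * ((if x n = 1 then 1 else 0) - (if x 0 = 1 then 1 else 0)) := by
  have h0 : ones (wordAt x n) = ∑ i ∈ Finset.range n, if x (i : ℤ) = 1 then 1 else 0 := by
    unfold ones
    rw [Finset.card_filter, Finset.sum_range]
    rfl
  rw [h0]
  unfold birkhoff
  induction n with
  | zero => simp
  | succ n ih =>
    rw [Finset.sum_range_succ, Finset.sum_range_succ, ih (by
      unfold ones
      rw [Finset.card_filter, Finset.sum_range]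
      rfl), phi_eq]
    · simp only [shift_it]
      push_cast
      rw [zero_add, add_comm (1 : ℤ)]
      ring
    · simp only [shift_it]
      rw [zero_add, add_comm (1 : ℤ)]
      exact hx n

lemma integral_phi (a00 a01 a1 : ℝ) (μ : Measure FullShift) [IsProbabilityMeasure μ] (e : ℝ)
    (h0 : (μ {x | x 0 = 1}).toReal = e) (h1 : (μ {x | x 1 = 1}).toReal = e)
    (h01 : μ {x | x 0 = 1 ∧ x 1 = 1} = 0) :
    ∫ x, phi012 a00 a01 a1 x ∂μ = a00 + (a1 + a01 - 2 * a00) * e := by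
  have hae : ∀ᵐ x ∂μ, phi012 a00 a01 a1 x = a00 + (a1 - a00) * ({x : FullShift | x 0 = 1}.indicator 1 x) +
      (a01 - a00) * ({x : FullShift | x 1 = 1}.indicator 1 x) := by
    have : ∀ᵐ x ∂μ, ¬ (x 0 = 1 ∧ x 1 = 1) := by
      rw [ae_iff]; simpa using h01
    filter_upwards [this] with x hx
    rw [phi_eq _ _ _ _ hx]
    simp [Set.indicator_apply]
  have hi : ∀ i, Integrable (fun x : FullShift => ({x : FullShift | x i = 1}.indicator (1 : FullShift → ℝ) x)) μ :=
    fun i => (integrable_const (1 : ℝ)).indicator (meas_one i)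
  have hs : Integrable (fun x : FullShift =>
      a00 + (a1 - a00) * ({x : FullShift | x 0 = 1}.indicator (1 : FullShift → ℝ) x)) μ :=
    (integrable_const _).add ((hi 0).const_mul _)
  rw [integral_congr_ae hae, integral_add hs ((hi 1).const_mul _), integral_add (integrable_const _) ((hi 0).const_mul _),
    integral_const_mul, integral_const_mul, integral_indicator_one (meas_one 0),
    integral_indicator_one (meas_one 1)]
  simp only [Measure.real, h0, h1, integral_const, measure_univ]
  simp
  ring

lemma supp_mem (b : ℕ → ℕ) (η : FullShift) (hη : ∀ m : ℤ, η m = 1 ↔ ∀ i, ¬ ((b i : ℤ) ∣ m))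
    (ν : Measure FullShift)
    (hgen : ∀ (k : ℕ) (W : Fin k → Fin 2),
      Tendsto (fun n : ℕ => (freqCount η W n : ℝ) / n) atTop
        (nhds ((ν (cylinder W)).toReal))) {n : ℕ} (V W : Fin n → Fin 2)
    (hV : (ν (cylinder V)).toReal ≠ 0) (hle : ∀ i, W i = 1 → V i = 1) : W ∈ LL b n := by
  classical
  have hex : ∃ j : ℕ, wordAt (shift^[j] η) n = V := by
    by_contra hcon
    push Not at hcon
    apply hV
    refine tendsto_nhds_unique (hgen n V) ?_
    refine tendsto_const_nhds.congr fun m => ?_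
    rw [freq_eq]
    simp [hcon]
  obtain ⟨j, hj⟩ := hex
  unfold LL
  rw [Finset.mem_filter]
  refine ⟨Finset.mem_univ _, ?_⟩
  let x : FullShift := fun m => if ∃ i : Fin n, ((i : ℕ) : ℤ) = m ∧ W i = 1 then 1 else 0
  refine ⟨x, eta_mem b η hη j x ?_, ?_⟩
  · intro m hm
    have : ∃ i : Fin n, ((i : ℕ) : ℤ) = m ∧ W i = 1 := by
      by_contra hcon
      simp [x, hcon] at hm
    obtain ⟨i, rfl, hi⟩ := this
    have h1 := hle i hi
    rw [← hj] at h1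
    simpa [wordAt, shift_it] using h1
  · intro i
    simp only [x]
    split_ifs with h
    · obtain ⟨k, hk, hk'⟩ := h
      have : k = i := by ext; exact_mod_cast hk
      rw [← this, hk']
    · symm
      apply fin2
      intro h1
      exact h ⟨i, rfl, h1⟩

lemma Zn_bounds (b : ℕ → ℕ) (h2 : b 0 = 2) (a00 a01 a1 : ℝ) (n : ℕ)
    (hpos : 0 < ∑ W ∈ LL b n, ((2 : ℝ) ^ (a1 + a01 - 2 * a00)) ^ ones W) :
    |Real.logb 2 (Zn (XB b) (phi012 a00 a01 a1) n) - (n * a00 +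
      Real.logb 2 (∑ W ∈ LL b n, ((2 : ℝ) ^ (a1 + a01 - 2 * a00)) ^ ones W))| ≤ |a01 - a00| := by
  classical
  set c := a1 + a01 - 2 * a00 with hc
  set C := |a01 - a00|
  have hbk : ∀ W : Fin n → Fin 2, ∀ x ∈ XB b ∩ cylinder W,
      |birkhoff (phi012 a00 a01 a1) n x - (n * a00 + c * ones W)| ≤ C := by
    intro W x hx
    rw [birk_eq _ _ _ x (XB_consec b h2 x hx.1), (mem_cyl _ _).1 hx.2, ← hc, add_sub_cancel_left,
      abs_mul]
    refine mul_le_of_le_one_right (abs_nonneg _) ?_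
    split_ifs <;> simp
  have hsup : ∀ W ∈ LL b n, |sSup ((birkhoff (phi012 a00 a01 a1) n) '' (XB b ∩ cylinder W)) -
      (n * a00 + c * ones W)| ≤ C := by
    intro W hW
    obtain ⟨x, hx⟩ := (Finset.mem_filter.1 hW).2
    have hub : ∀ y ∈ (birkhoff (phi012 a00 a01 a1) n) '' (XB b ∩ cylinder W),
        y ≤ (n * a00 + c * ones W) + C := by
      rintro _ ⟨z, hz, rfl⟩
      have := (abs_le.1 (hbk W z hz)).2
      linarith
    rw [abs_le]
    constructor
    · have h1 := le_csSup (⟨_, hub⟩ : BddAbove _) (Set.mem_image_of_mem _ hx)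
      have := (abs_le.1 (hbk W x hx)).1
      linarith
    · have := csSup_le (⟨_, Set.mem_image_of_mem _ hx⟩ : Set.Nonempty _) hub
      linarith
  have hterm : ∀ e : ℝ, ∀ W : Fin n → Fin 2, (2 : ℝ) ^ (n * a00 + c * ones W + e) =
      (2 : ℝ) ^ (n * a00 + e) * ((2 : ℝ) ^ c) ^ ones W := by
    intro e W
    rw [← Real.rpow_natCast, ← Real.rpow_mul (by norm_num), ← Real.rpow_add (by norm_num)]
    congr 1
    ring
  have hZ : Zn (XB b) (phi012 a00 a01 a1) n = ∑ W ∈ LL b n,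
      (2 : ℝ) ^ (sSup ((birkhoff (phi012 a00 a01 a1) n) '' (XB b ∩ cylinder W))) := rfl
  set Z := ∑ W ∈ LL b n, ((2 : ℝ) ^ c) ^ ones W
  have hlog : ∀ e : ℝ, Real.logb 2 ((2 : ℝ) ^ (n * a00 + e) * Z) = n * a00 + e + Real.logb 2 Z := by
    intro e
    rw [Real.logb_mul (by positivity) hpos.ne', Real.logb_rpow (by norm_num) (by norm_num)]
  have hup : Zn (XB b) (phi012 a00 a01 a1) n ≤ (2 : ℝ) ^ (n * a00 + C) * Z := by
    rw [hZ, Finset.mul_sum]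
    apply Finset.sum_le_sum
    intro W hW
    rw [← hterm]
    apply Real.rpow_le_rpow_of_exponent_le (by norm_num)
    have := (abs_le.1 (hsup W hW)).2
    linarith
  have hlo : (2 : ℝ) ^ (n * a00 + -C) * Z ≤ Zn (XB b) (phi012 a00 a01 a1) n := by
    rw [hZ, Finset.mul_sum]
    apply Finset.sum_le_sum
    intro W hW
    rw [← hterm]
    apply Real.rpow_le_rpow_of_exponent_le (by norm_num)
    have := (abs_le.1 (hsup W hW)).1
    linarith
  have hlp : 0 < (2 : ℝ) ^ (n * a00 + -C) * Z := by positivity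
  have e1 := Real.logb_le_logb_of_le (b := 2) (by norm_num) hlp hlo
  have e2 := Real.logb_le_logb_of_le (b := 2) (by norm_num) (hlp.trans_le hlo) hup
  rw [hlog] at e1 e2
  rw [abs_le]
  constructor <;> linarith

end BF

open BF in
open Classical in
theorem stmt18 (b : ℕ → ℕ) (hb : ∀ i, 2 ≤ b i)
    (hcop : ∀ i j, i ≠ j → Nat.Coprime (b i) (b j))
    (hsum : Summable fun i => (1 : ℝ) / b i) (h2 : b 0 = 2)
    (η : FullShift) (hη : ∀ m : ℤ, η m = 1 ↔ ∀ i, ¬ ((b i : ℤ) ∣ m))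
    (ν B : Measure FullShift) [IsProbabilityMeasure ν] [IsProbabilityMeasure B]
    (hgen : ∀ (k : ℕ) (W : Fin k → Fin 2),
      Tendsto (fun n : ℕ => (freqCount η W n : ℝ) / n) atTop
        (nhds ((ν (cylinder W)).toReal)))
    (a00 a01 a1 : ℝ)
    (p : ℝ) (hp : p = (2 : ℝ) ^ (2 * a00) / ((2 : ℝ) ^ (a1 + a01) + (2 : ℝ) ^ (2 * a00)))
    (hB : ∀ (n : ℕ) (W : Fin n → Fin 2),
      (B (cylinder W)).toReal = p ^ zeros W * (1 - p) ^ ones W) :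
    ∃ h P : ℝ,
      Tendsto (fun n : ℕ => Hn ((ν.prod B).map Qmul) n / n) atTop (nhds h) ∧
      Tendsto (fun n : ℕ => Real.logb 2 (Zn (XB b) (phi012 a00 a01 a1) n) / n)
        atTop (nhds P) ∧
      h + ∫ x, phi012 a00 a01 a1 x ∂((ν.prod B).map Qmul) = P := by
  obtain ⟨d, hd⟩ := DD_lim η ν hgen
  set c := a1 + a01 - 2 * a00 with hc
  set t : ℝ := (2 : ℝ) ^ c with ht'
  have ht : 0 < t := by positivity
  have hsplit : (2 : ℝ) ^ (a1 + a01) = t * (2 : ℝ) ^ (2 * a00) := by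
    rw [ht', ← Real.rpow_add (by norm_num)]
    congr 1
    rw [hc]; ring
  have hpp : p = 1 / (1 + t) := by
    rw [hp, hsplit]
    have : (0 : ℝ) < (2 : ℝ) ^ (2 * a00) := by positivity
    field_simp
    ring
  have hp0 : 0 < p := by rw [hpp]; positivity
  have hp1 : 1 - p = t * p := by
    rw [hpp]; field_simp; ring
  set μ := (ν.prod B).map Qmul with hμ
  have : IsProbabilityMeasure μ := Measure.isProbabilityMeasure_map meas_Q.aemeasurable
  have hν1 := nu_one η ν hgen d hd
  have hμ1 : ∀ i : ℕ, (μ {x | x (i : ℤ) = 1}).toReal = d * (1 - p) := by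
    intro i
    rw [hμ, mu_one, hν1, B_one B t p hp1 hB]
  have hmu : ∀ (n : ℕ) (W : Fin n → Fin 2), (μ (cylinder W)).toReal =
      ∑ V : Fin n → Fin 2, (ν (cylinder V)).toReal * kv t p V W := by
    intro n W
    rw [hμ, mu_cyl]
    simp_rw [hB, B_eq t p hp1]
    rfl
  have hlow : ∀ n : ℕ, n * d * Real.log (1 + t) - n * (d * (1 - p)) * Real.log t ≤
      ∑ W : Fin n → Fin 2, Real.negMulLog (μ (cylinder W)).toReal := by
    intro n
    have := ent_low t p ht hp0 hp1 (fun V : Fin n → Fin 2 => (ν (cylinder V)).toReal)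
      (fun W => (μ (cylinder W)).toReal) (fun V => ENNReal.toReal_nonneg) (sum_cyl ν n) (hmu n)
    rwa [exp_ones ν n d hν1, exp_ones μ n _ hμ1] at this
  have hsupp : ∀ (n : ℕ) (W : Fin n → Fin 2), W ∉ LL b n → (μ (cylinder W)).toReal = 0 := by
    intro n W hW
    rw [hmu]
    apply Finset.sum_eq_zero
    intro V _
    by_cases hV : (ν (cylinder V)).toReal = 0
    · rw [hV, zero_mul]
    · rw [kv_eq t p hp1, if_neg, mul_zero]
      intro hle
      exact hW (supp_mem b η hη ν hgen V W hV hle)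
  have hsum1 : ∀ n : ℕ, ∑ W ∈ LL b n, (μ (cylinder W)).toReal = 1 := by
    intro n
    rw [← sum_cyl μ n]
    exact Finset.sum_subset (Finset.subset_univ _) fun W _ hW => hsupp n W hW
  have hup : ∀ n : ℕ, ∑ W : Fin n → Fin 2, Real.negMulLog (μ (cylinder W)).toReal +
      n * (d * (1 - p)) * Real.log t ≤ Real.log (∑ W ∈ LL b n, t ^ ones W) := by
    intro n
    refine le_trans (le_of_eq ?_) (gibbs (LL b n) (fun W => (μ (cylinder W)).toReal)
      (fun W => t ^ ones W) (fun W => ENNReal.toReal_nonneg) (hsum1 n) (fun W => by positivity))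
    rw [← exp_ones μ n _ hμ1, Finset.sum_mul, ← Finset.sum_add_distrib]
    symm
    rw [← Finset.sum_subset (Finset.subset_univ (LL b n))]
    · apply Finset.sum_congr rfl
      intro W _
      rw [Real.log_pow]
      ring
    · intro W _ hW
      rw [hsupp n W hW]
      simp
  have hpos : ∀ n : ℕ, 0 < ∑ W ∈ LL b n, t ^ ones W := by
    intro n
    apply Finset.sum_pos (fun W _ => by positivity)
    rw [Finset.nonempty_iff_ne_empty]
    intro h
    have := hsum1 n
    rw [h] at this
    simp at this
  have hZ := Z_lim b hb hcop hsum η hη d hd t ht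
    (fun n => by have h1 := hlow n; have h2 := hup n; linarith) hpos
  have hl2 : 0 < Real.log 2 := Real.log_pos (by norm_num)
  have hlt : Real.log t = c * Real.log 2 := by rw [ht', Real.log_rpow (by norm_num)]
  have hHn : ∀ n : ℕ, Hn μ n =
      (∑ W : Fin n → Fin 2, Real.negMulLog (μ (cylinder W)).toReal) / Real.log 2 := by
    intro n
    unfold Hn
    rw [← Finset.sum_neg_distrib, Finset.sum_div]
    apply Finset.sum_congr rfl
    intro W _
    unfold Real.negMulLog Real.logb
    ring
  refine ⟨d * Real.log (1 + t) / Real.log 2 - c * (d * (1 - p)),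
    a00 + d * Real.log (1 + t) / Real.log 2, ?_, ?_, ?_⟩
  · have hu : Tendsto (fun n : ℕ => Real.log (∑ W ∈ LL b n, t ^ ones W) / n / Real.log 2
        - c * (d * (1 - p))) atTop
        (nhds (d * Real.log (1 + t) / Real.log 2 - c * (d * (1 - p)))) :=
      (hZ.div_const _).sub tendsto_const_nhds
    refine tendsto_of_tendsto_of_tendsto_of_le_of_le' tendsto_const_nhds hu ?_ ?_
    · filter_upwards [eventually_gt_atTop 0] with n hn
      have hn' : (0 : ℝ) < n := by exact_mod_cast hn
      have h1 := hlow n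
      rw [hHn, le_div_iff₀ hn', le_div_iff₀ hl2]
      rw [hlt] at h1
      refine le_trans (le_of_eq ?_) h1
      field_simp
    · filter_upwards [eventually_gt_atTop 0] with n hn
      have hn' : (0 : ℝ) < n := by exact_mod_cast hn
      have h1 := hup n
      rw [hHn, div_le_iff₀ hn', div_le_iff₀ hl2]
      rw [hlt] at h1
      refine (le_sub_iff_add_le.2 h1).trans (le_of_eq ?_)
      field_simp
  · have hu : Tendsto (fun n : ℕ => a00 + Real.log (∑ W ∈ LL b n, t ^ ones W) / n / Real.log 2)
        atTop (nhds (a00 + d * Real.log (1 + t) / Real.log 2)) :=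
      tendsto_const_nhds.add (hZ.div_const _)
    have hdiff : Tendsto (fun n : ℕ => Real.logb 2 (Zn (XB b) (phi012 a00 a01 a1) n) / n -
        (a00 + Real.log (∑ W ∈ LL b n, t ^ ones W) / n / Real.log 2)) atTop (nhds 0) := by
      refine squeeze_zero_norm' ?_ (tendsto_const_div_atTop_nhds_zero_nat |a01 - a00|)
      filter_upwards [eventually_gt_atTop 0] with n hn
      have hn' : (0 : ℝ) < n := by exact_mod_cast hn
      have h1 := Zn_bounds b h2 a00 a01 a1 n (hpos n)
      rw [← hc, ← ht'] at h1
      rw [Real.norm_eq_abs, le_div_iff₀ hn']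
      refine le_trans (le_of_eq ?_) h1
      conv_lhs => rw [← abs_of_pos hn', ← abs_mul, abs_of_pos hn']
      congr 1
      rw [Real.logb, Real.logb]
      field_simp
    have := hdiff.add hu
    simpa using this
  · rw [integral_phi a00 a01 a1 μ (d * (1 - p)) (by simpa using hμ1 0) (by simpa using hμ1 1)]
    · ring
    · have hcyl : ν (cylinder (fun _ : Fin 2 => (1 : Fin 2))) = 0 := by
        have h0 : (ν (cylinder (fun _ : Fin 2 => (1 : Fin 2)))).toReal = 0 := by
          refine tendsto_nhds_unique (hgen 2 _) ?_
          refine tendsto_const_nhds.congr fun m => ?_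
          rw [freq_eq]
          have : ∀ j : ℕ, wordAt (shift^[j] η) 2 ≠ fun _ => 1 := by
            intro j hj
            apply XB_consec b h2 η (eta_mem b η hη 0 η (fun m hm => by simpa using hm)) j
            have e0 := congrFun hj 0
            have e1 := congrFun hj 1
            simp only [wordAt, shift_it] at e0 e1
            refine ⟨by simpa using e0, ?_⟩
            rw [add_comm]
            simpa using e1
          simp [this]
        exact (ENNReal.toReal_eq_zero_iff _).1 h0 |>.resolve_right (measure_ne_top _ _)
      have hm : MeasurableSet {x : FullShift | x 0 = 1 ∧ x 1 = 1} :=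
        (meas_one 0).inter (meas_one 1)
      rw [hμ, Measure.map_apply meas_Q hm]
      refine measure_mono_null (t := cylinder (fun _ : Fin 2 => (1 : Fin 2)) ×ˢ Set.univ) ?_ ?_
      · rintro ⟨x, y⟩ ⟨e0, e1⟩
        have key : ∀ u v : Fin 2, u * v = 1 → u = 1 := by decide
        refine ⟨?_, Set.mem_univ _⟩
        intro i
        fin_cases i
        · exact key _ _ e0
        · exact key _ _ e1
      · rw [Measure.prod_prod, hcyl, zero_mul]
end
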